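/- arXiv:2412.09118 — 6 statements merged into one kernel-verified Lean document; each statement's English description precedes it below -/
import Mathlib

section
/- Let D be a probability measure on X × T with time marginal P_T, and let W₁, W₂ be measurable subsets of T with 0 < P_T(W₁) ≤ P_T(W₂). Then for every measurable A ⊆ X, |D_{W₁}(A) − D_{W₂}(A)| ≤ 2 · P_T(W₁ △ W₂) / P_T(W₁), where W₁ △ W₂ denotes the symmetric difference. -/
open MeasureTheory Set

/-- Two rectangles over the same base differ in measure by at most the mass of the symmetric
difference of the windows. -/
theorem abs_measureReal_prod_sub_le_symmDiff {X T : Type*} [MeasurableSpace X]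
    [MeasurableSpace T] (D : Measure (X × T)) [IsFiniteMeasure D] {W₁ W₂ : Set T}
    (hW₁ : MeasurableSet W₁) (hW₂ : MeasurableSet W₂) {A : Set X} (hA : MeasurableSet A) :
    |D.real (A ×ˢ W₁) - D.real (A ×ˢ W₂)| ≤ D.real (Set.univ ×ˢ symmDiff W₁ W₂) := by
  refine (abs_measureReal_sub_le_measureReal_symmDiff (hA.prod hW₁).nullMeasurableSet
    (hA.prod hW₂).nullMeasurableSet).trans
    (measureReal_mono ?_)
  rintro ⟨x, t⟩ h
  simp only [Set.mem_symmDiff, Set.mem_prod, Set.mem_univ, true_and] at h ⊢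
  tauto

/-- If `0 ≤ b ≤ q` and `0 < p ≤ q`, and `a`, `p` are within `s` of `b`, `q` respectively, then the
ratios `a / p` and `b / q` are within `2 * s / p`. -/
theorem abs_div_sub_div_le_two_mul_div {a b p q s : ℝ} (hp : 0 < p) (hpq : p ≤ q)
    (hb : 0 ≤ b) (hbq : b ≤ q) (hab : |a - b| ≤ s) (hs : |p - q| ≤ s) :
    |a / p - b / q| ≤ 2 * s / p := by
  have hq : 0 < q := hp.trans_le hpq
  have hbq1 : b / q ≤ 1 := (div_le_one hq).2 hbq
  have hbq0 : 0 ≤ b / q := div_nonneg hb hq.le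
  have h : a / p - b / q = ((a - b) - b / q * (p - q)) / p := by
    field_simp
    ring
  rw [h, abs_div, abs_of_pos hp]
  gcongr
  calc |(a - b) - b / q * (p - q)| ≤ |a - b| + |b / q * (p - q)| := abs_sub _ _
    _ = |a - b| + b / q * |p - q| := by rw [abs_mul, abs_of_nonneg hbq0]
    _ ≤ s + 1 * s := by gcongr
    _ = 2 * s := by ring

/-- For a probability measure `D` on `X × T` with time marginal
`P_T (S) = D (univ ×ˢ S)` and window mean distributions
`D_W (A) = D (A ×ˢ W) / P_T (W)`, if `0 < P_T W₁ ≤ P_T W₂` then for every measurable `A`,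
`|D_{W₁}(A) − D_{W₂}(A)| ≤ 2 · P_T (W₁ △ W₂) / P_T (W₁)`. -/
theorem window_mean_symmDiff_bound
    {X T : Type*} [MeasurableSpace X] [MeasurableSpace T]
    (D : Measure (X × T)) [IsProbabilityMeasure D]
    (W₁ W₂ : Set T) (hW₁ : MeasurableSet W₁) (hW₂ : MeasurableSet W₂)
    (hpos : 0 < D (Set.univ ×ˢ W₁))
    (hle : D (Set.univ ×ˢ W₁) ≤ D (Set.univ ×ˢ W₂))
    (A : Set X) (hA : MeasurableSet A) :
    |(D (A ×ˢ W₁) / D (Set.univ ×ˢ W₁)).toReal -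
        (D (A ×ˢ W₂) / D (Set.univ ×ˢ W₂)).toReal| ≤
      2 * (D (Set.univ ×ˢ (symmDiff W₁ W₂))).toReal / (D (Set.univ ×ˢ W₁)).toReal := by
  rw [ENNReal.toReal_div, ENNReal.toReal_div]
  exact abs_div_sub_div_le_two_mul_div
    (ENNReal.toReal_pos hpos.ne' (measure_ne_top D _))
    (ENNReal.toReal_mono (measure_ne_top D _) hle) ENNReal.toReal_nonneg
    (measureReal_mono (Set.prod_mono_left (Set.subset_univ A)))
    (abs_measureReal_prod_sub_le_symmDiff D hW₁ hW₂ hA)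
    (abs_measureReal_prod_sub_le_symmDiff D hW₁ hW₂ MeasurableSet.univ)
end

section
/- Let (W, N) be a window system on (T, Σ_T) with finite horizon and let μ be a finite pre-measure on the semi-ring W ∪ N. Then μ extends to a measure on Σ_T, and this extension is unique: any two measures on Σ_T restricting to μ on W ∪ N agree on all of Σ_T. Moreover, if μ(N) = 0 for all N ∈ N, then for any W ∈ W with T \ W ∈ N the extension μ* satisfies μ(W) = μ*(T). -/
open MeasureTheory Set Filter Topology
open scoped ENNReal

/-- A window system `(𝒲, 𝒩)` on a measurable space `T`: `𝒩` is a σ-ideal of null windows,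
`𝒲` is closed under finite disjoint unions, `𝒲` and `𝒩` are disjoint, `𝒲 ∪ 𝒩` is a
semi-ring of sets, `𝒲` locally generates the σ-algebra, and `𝒲` covers `T`. -/
structure IsWindowSystem {T : Type*} [MeasurableSpace T] (𝒲 𝒩 : Set (Set T)) : Prop where
  measurable_window : ∀ W ∈ 𝒲, MeasurableSet W
  measurable_null : ∀ N ∈ 𝒩, MeasurableSet N
  empty_mem_null : ∅ ∈ 𝒩
  null_mono : ∀ N ∈ 𝒩, ∀ S : Set T, MeasurableSet S → S ⊆ N → S ∈ 𝒩
  null_iUnion : ∀ f : ℕ → Set T, (∀ n, f n ∈ 𝒩) → (⋃ n, f n) ∈ 𝒩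
  window_disjUnion : ∀ W₁ ∈ 𝒲, ∀ W₂ ∈ 𝒲, Disjoint W₁ W₂ → W₁ ∪ W₂ ∈ 𝒲
  window_null_disjoint : 𝒲 ∩ 𝒩 = ∅
  inter_mem : ∀ A ∈ 𝒲 ∪ 𝒩, ∀ B ∈ 𝒲 ∪ 𝒩, A ∩ B ∈ 𝒲 ∪ 𝒩
  diff_eq_disjUnion : ∀ A ∈ 𝒲 ∪ 𝒩, ∀ B ∈ 𝒲 ∪ 𝒩, ∃ (n : ℕ) (C : Fin n → Set T),
    (∀ i, C i ∈ 𝒲 ∪ 𝒩) ∧ Pairwise (Function.onFun Disjoint C) ∧ A \ B = ⋃ i, C i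
  locally_generates : ∀ W ∈ 𝒲, ∀ S : Set T, MeasurableSet S →
    MeasurableSet[MeasurableSpace.generateFrom (𝒲 ∪ 𝒩)] (S ∩ W)
  covers : ∀ S : Set T, MeasurableSet S → (∀ W ∈ 𝒲, S ∩ W ∈ 𝒩) → S ∈ 𝒩


/-- Countable additivity along `ℕ` yields countable additivity along any countable index type. -/
lemma iUnion_eq_tsum_of_countable {α ι : Type*} [Countable ι] {C : Set (Set α)}
    {μ : Set α → ℝ≥0∞} (hC : ∅ ∈ C) (hμ_empty : μ ∅ = 0)
    (hμ : ∀ f : ℕ → Set α, (∀ n, f n ∈ C) → Pairwise (Function.onFun Disjoint f) →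
      (⋃ n, f n) ∈ C → μ (⋃ n, f n) = ∑' n, μ (f n))
    {f : ι → Set α} (hf : ∀ i, f i ∈ C) (hd : Pairwise (Function.onFun Disjoint f))
    (hU : (⋃ i, f i) ∈ C) : μ (⋃ i, f i) = ∑' i, μ (f i) := by
  have := Encodable.ofCountable ι
  rw [← Encodable.iUnion_decode₂] at hU ⊢
  rw [← tsum_iUnion_decode₂ μ hμ_empty]
  exact hμ _ (fun _ ↦ Encodable.iUnion_decode₂_cases hC hf)
    (Encodable.iUnion_decode₂_disjoint_on hd) hU

/-- A countably additive set function that vanishes on the empty set is an additive content. -/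
def addContentOfCountablyAdditive {α : Type*} {C : Set (Set α)} (μ : Set α → ℝ≥0∞)
    (hC : ∅ ∈ C) (hμ_empty : μ ∅ = 0)
    (hμ : ∀ f : ℕ → Set α, (∀ n, f n ∈ C) → Pairwise (Function.onFun Disjoint f) →
      (⋃ n, f n) ∈ C → μ (⋃ n, f n) = ∑' n, μ (f n)) : AddContent ℝ≥0∞ C where
  toFun := μ
  empty' := hμ_empty
  sUnion' I hI hd hU := by
    rw [sUnion_eq_iUnion] at hU ⊢
    change μ (⋃ i : I, (i : Set α)) = _
    rw [iUnion_eq_tsum_of_countable hC hμ_empty hμ (fun i : I ↦ hI i.2)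
      (fun i j hij ↦ hd i.2 j.2 (Subtype.coe_ne_coe.mpr hij)) hU]
    exact Finset.tsum_subtype I μ

/-- A countably additive content on a semi-ring of sets is countably subadditive. -/
lemma isSigmaSubadditive_of_isSetSemiring {α : Type*} {C : Set (Set α)} (hC : IsSetSemiring C)
    (m : AddContent ℝ≥0∞ C)
    (hm : ∀ f : ℕ → Set α, (∀ n, f n ∈ C) → Pairwise (Function.onFun Disjoint f) →
      (⋃ n, f n) ∈ C → m (⋃ n, f n) = ∑' n, m (f n)) : m.IsSigmaSubadditive := by
  classical
  intro f hf hU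
  have hD : ∀ n, ∃ D : Finset (Set α), ↑D ⊆ C ∧ PairwiseDisjoint (D : Set (Set α)) id ∧
      disjointed f n = ⋃₀ D := by
    intro n
    obtain ⟨D, hDC, hDd, hDU⟩ := hC.exists_disjoint_finset_sdiff_eq (hf n)
      (I := (Finset.Iio n).image f) (by simpa [Set.subset_def] using fun k _ ↦ hf k)
    refine ⟨D, hDC, hDd, ?_⟩
    rw [← hDU, disjointed_apply, Finset.sup_set_eq_biUnion, sUnion_eq_biUnion, Finset.coe_image,
      biUnion_image]
    simp
  choose D hDC hDd hDU using hD
  have hsub : ∀ n, ∀ u ∈ D n, u ⊆ disjointed f n := fun n u hu ↦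
    hDU n ▸ subset_sUnion_of_mem hu
  have hUnion : ⋃ p : Σ n, D n, (p.2 : Set α) = ⋃ n, f n := by
    rw [← iUnion_disjointed (f := f), iUnion_sigma]
    exact iUnion_congr fun n ↦ by rw [hDU n, sUnion_eq_iUnion]; rfl
  have hdisj : Pairwise (Function.onFun Disjoint fun p : Σ n, D n ↦ (p.2 : Set α)) := by
    rintro ⟨i, u⟩ ⟨j, v⟩ hne
    obtain rfl | hij := eq_or_ne i j
    · exact hDd i u.2 v.2 fun h ↦ hne (by rw [Subtype.ext h])
    · exact (disjoint_disjointed f hij).mono (hsub i u u.2) (hsub j v v.2)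
  rw [← hUnion, iUnion_eq_tsum_of_countable hC.empty_mem addContent_empty hm
    (fun p ↦ hDC p.1 p.2.2) hdisj (hUnion ▸ hU), ENNReal.tsum_sigma fun n (u : D n) ↦ m (u : Set α)]
  refine ENNReal.tsum_le_tsum fun n ↦ ?_
  rw [Finset.tsum_subtype (D n) m]
  exact sum_addContent_le_of_subset hC (hDC n) (hDd n) (hf n)
    fun u hu ↦ (hsub n u hu).trans (disjointed_subset f n)

namespace IsWindowSystem

variable {T : Type*} [MeasurableSpace T] {𝒲 𝒩 : Set (Set T)}

lemma isSetSemiring (h : IsWindowSystem 𝒲 𝒩) : IsSetSemiring (𝒲 ∪ 𝒩) where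
  empty_mem := Or.inr h.empty_mem_null
  inter_mem := h.inter_mem
  sdiff_eq_sUnion' A hA B hB := by
    classical
    obtain ⟨n, D, hD, hd, hU⟩ := h.diff_eq_disjUnion A hA B hB
    refine ⟨Finset.univ.image D, by simpa [Set.subset_def] using hD, ?_, by simpa using hU⟩
    rw [Finset.coe_image, Finset.coe_univ, image_univ]
    exact pairwiseDisjoint_range_iff.mpr fun i j hij ↦ hd (ne_of_apply_ne D hij)

/-- With finite horizon, the windows and null windows generate the whole σ-algebra. -/
lemma eq_generateFrom (h : IsWindowSystem 𝒲 𝒩) (hfh : ∃ W ∈ 𝒲, Wᶜ ∈ 𝒩) :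
    ‹MeasurableSpace T› = MeasurableSpace.generateFrom (𝒲 ∪ 𝒩) := by
  obtain ⟨W, hW, hWc⟩ := hfh
  refine le_antisymm (fun S hS ↦ ?_) (MeasurableSpace.generateFrom_le ?_)
  · rw [← inter_union_compl S W]
    refine MeasurableSet.union (h.locally_generates W hW S hS)
      (MeasurableSpace.measurableSet_generateFrom (Or.inr ?_))
    exact h.null_mono _ hWc _ (hS.inter (h.measurable_null _ hWc)) inter_subset_right
  · rintro S (hS | hS)
    exacts [h.measurable_window S hS, h.measurable_null S hS]

/-- Measures that agree on the windows and null windows, and are finite there, are equal. -/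
lemma measure_ext (h : IsWindowSystem 𝒲 𝒩) (hfh : ∃ W ∈ 𝒲, Wᶜ ∈ 𝒩) {ν₁ ν₂ : Measure T}
    (hfin : ∀ S ∈ 𝒲 ∪ 𝒩, ν₁ S < ⊤) (heq : ∀ S ∈ 𝒲 ∪ 𝒩, ν₁ S = ν₂ S) : ν₁ = ν₂ := by
  obtain ⟨W, hW, hWc⟩ := id hfh
  have hWm := h.measurable_window W hW
  have : IsFiniteMeasure ν₁ := ⟨by
    rw [← measure_add_measure_compl hWm]
    exact ENNReal.add_lt_top.mpr ⟨hfin W (Or.inl hW), hfin _ (Or.inr hWc)⟩⟩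
  refine ext_of_generate_finite _ (h.eq_generateFrom hfh) h.isSetSemiring.isPiSystem heq ?_
  rw [← measure_add_measure_compl hWm, ← measure_add_measure_compl hWm,
    heq W (Or.inl hW), heq _ (Or.inr hWc)]

end IsWindowSystem

/-- Carathéodory's extension theorem for window systems with finite
horizon. Let `(𝒲, 𝒩)` be a window system on `(T, Σ_T)` with finite horizon and `μ` a
finite pre-measure on the semi-ring `𝒲 ∪ 𝒩` (countably additive, vanishing on `∅`).
Then `μ` extends to a measure on `Σ_T`; any two measures restricting to `μ` on `𝒲 ∪ 𝒩`
agree on all measurable sets; and if `μ` vanishes on `𝒩`, then for any `W ∈ 𝒲` with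
`T \ W ∈ 𝒩` the extension `ν` satisfies `μ W = ν univ`. -/
theorem windowSystem_caratheodory_extension
    {T : Type*} [m : MeasurableSpace T] (𝒲 𝒩 : Set (Set T))
    (hWS : IsWindowSystem 𝒲 𝒩)
    (hfh : ∃ W ∈ 𝒲, Wᶜ ∈ 𝒩)
    (μ : Set T → ℝ≥0∞)
    (hμ_empty : μ ∅ = 0)
    (hμ_fin : ∀ S ∈ 𝒲 ∪ 𝒩, μ S < ⊤)
    (hμ_sigma_add : ∀ f : ℕ → Set T, (∀ n, f n ∈ 𝒲 ∪ 𝒩) →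
      Pairwise (Function.onFun Disjoint f) → (⋃ n, f n) ∈ 𝒲 ∪ 𝒩 →
        μ (⋃ n, f n) = ∑' n, μ (f n)) :
    ∃ ν : Measure T,
      (∀ S ∈ 𝒲 ∪ 𝒩, ν S = μ S) ∧
      (∀ ν₁ ν₂ : Measure T, (∀ S ∈ 𝒲 ∪ 𝒩, ν₁ S = μ S) → (∀ S ∈ 𝒲 ∪ 𝒩, ν₂ S = μ S) →
        ∀ S : Set T, MeasurableSet S → ν₁ S = ν₂ S) ∧
      ((∀ N ∈ 𝒩, μ N = 0) → ∀ W ∈ 𝒲, Wᶜ ∈ 𝒩 → μ W = ν Set.univ) := by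
  have hC := hWS.isSetSemiring
  have hgen := hWS.eq_generateFrom hfh
  let c := addContentOfCountablyAdditive μ hC.empty_mem hμ_empty hμ_sigma_add
  have hc : c.IsSigmaSubadditive := isSigmaSubadditive_of_isSetSemiring hC c hμ_sigma_add
  have hν : ∀ S ∈ 𝒲 ∪ 𝒩, c.measure hC hgen.le hc S = μ S := fun S hS ↦
    c.measure_eq hC hgen hc hS
  refine ⟨c.measure hC hgen.le hc, hν, fun ν₁ ν₂ h₁ h₂ S _ ↦ ?_, fun hnull W hW hWc ↦ ?_⟩
  · rw [hWS.measure_ext hfh (fun S hS ↦ h₁ S hS ▸ hμ_fin S hS)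
      fun S hS ↦ (h₁ S hS).trans (h₂ S hS).symm]
  · rw [← measure_add_measure_compl (hWS.measurable_window W hW), hν W (Or.inl hW),
      hν _ (Or.inr hWc), hnull _ hWc, add_zero]
end

section
/- Let (W, N, (D_W)) be a non-constant windowed distribution system with finite horizon. Then every finite, finitely additive set function P_T on W ∪ N satisfying the compatibility conditions (0 < P_T(W) < ∞ for W ∈ W; P_T(N) = 0 for N ∈ N; D_W = (Σ_i P_T(W_i) D_{W_i})/(Σ_i P_T(W_i)) for disjoint windows with union a window) is σ-additive on W ∪ N and extends uniquely to a measure on Σ_T compatible with the WDS. -/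
open MeasureTheory Set Filter Topology
open scoped ENNReal

/-- A window system has a finite horizon if some window has null complement. -/
def HasFiniteHorizon {T : Type*} [MeasurableSpace T] (𝒲 𝒩 : Set (Set T)) : Prop :=
  ∃ W ∈ 𝒲, Wᶜ ∈ 𝒩

/-- A windowed distribution system `(𝒲, 𝒩, 𝒟)` on `X`: a family of probability measures on
`X` indexed by the windows, invariant under null-window modifications, setwise continuous
along increasing sequences of windows, and compatible with disjoint unions via convex
combinations with positive weights. -/
structure IsWDS {X T : Type*} [MeasurableSpace X] [MeasurableSpace T]
    (𝒲 𝒩 : Set (Set T)) (𝒟 : Set T → Measure X) : Prop where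
  prob : ∀ W ∈ 𝒲, IsProbabilityMeasure (𝒟 W)
  null_invariant : ∀ W₁ ∈ 𝒲, ∀ W₂ ∈ 𝒲, symmDiff W₁ W₂ ∈ 𝒩 → 𝒟 W₁ = 𝒟 W₂
  continuous : ∀ f : ℕ → Set T, Monotone f → (∀ n, f n ∈ 𝒲) → (⋃ n, f n) ∈ 𝒲 →
    ∀ A : Set X, MeasurableSet A →
      Tendsto (fun n => 𝒟 (f n) A) atTop (𝓝 (𝒟 (⋃ n, f n) A))
  convex : ∀ (n : ℕ) (W : Fin n → Set T), (∀ i, W i ∈ 𝒲) →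
    Pairwise (Function.onFun Disjoint W) →
    ∃ l : Fin n → ℝ≥0∞, (∀ i, 0 < l i ∧ l i < ⊤) ∧
      ∀ I : Finset (Fin n), I.Nonempty → (⋃ i ∈ I, W i) ∈ 𝒲 →
        𝒟 (⋃ i ∈ I, W i) = (∑ i ∈ I, l i)⁻¹ • ∑ i ∈ I, l i • 𝒟 (W i)

/-- The WDS is constant if all window distributions coincide. -/
def IsConstantWDS {X T : Type*} [MeasurableSpace X]
    (𝒲 : Set (Set T)) (𝒟 : Set T → Measure X) : Prop :=
  ∀ W₁ ∈ 𝒲, ∀ W₂ ∈ 𝒲, 𝒟 W₁ = 𝒟 W₂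

/-- A measure `P` on `T` is a compatible time distribution for the WDS `(𝒲, 𝒩, 𝒟)`. -/
structure IsCompatibleTimeDistribution {X T : Type*} [MeasurableSpace X] [MeasurableSpace T]
    (𝒲 𝒩 : Set (Set T)) (𝒟 : Set T → Measure X) (P : Measure T) : Prop where
  pos : ∀ W ∈ 𝒲, 0 < P W ∧ P W < ⊤
  null : ∀ N ∈ 𝒩, P N = 0
  mix : ∀ (n : ℕ) (W : Fin n → Set T), (∀ i, W i ∈ 𝒲) →
    Pairwise (Function.onFun Disjoint W) → (⋃ i, W i) ∈ 𝒲 →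
      𝒟 (⋃ i, W i) = (∑ i, P (W i))⁻¹ • ∑ i, P (W i) • 𝒟 (W i)

section SetAlgebra

variable {T : Type*} {𝒜 : Set (Set T)} {m M : Set T → ℝ}

/-- A finitely additive nonnegative set function is monotone along increasing sequences. -/
lemma monotone_comp_of_additive (hA : IsSetAlgebra 𝒜) (hm0 : ∀ S ∈ 𝒜, 0 ≤ m S)
    (hmadd : ∀ S ∈ 𝒜, ∀ S' ∈ 𝒜, Disjoint S S' → m (S ∪ S') = m S + m S')
    {f : ℕ → Set T} (hf : Monotone f) (hfA : ∀ n, f n ∈ 𝒜) :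
    Monotone fun n => m (f n) := by
  intro i j hij
  have hd : f j \ f i ∈ 𝒜 := hA.isSetRing.sdiff_mem (hfA j) (hfA i)
  have := hmadd _ (hfA i) _ hd disjoint_sdiff_self_right
  rw [union_sdiff_cancel (hf hij)] at this
  have := hm0 _ hd
  simp only
  linarith

/-- If `m` loses mass along a sequence increasing to `B`, then the ratio `M / m` on any set `A`
disjoint from `B` agrees with the ratio on `B`. -/
lemma ratio_eq_of_mass_loss (hA : IsSetAlgebra 𝒜)
    (hmadd : ∀ S ∈ 𝒜, ∀ S' ∈ 𝒜, Disjoint S S' → m (S ∪ S') = m S + m S')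
    (hMadd : ∀ S ∈ 𝒜, ∀ S' ∈ 𝒜, Disjoint S S' → M (S ∪ S') = M S + M S')
    (hM0 : ∀ S ∈ 𝒜, m S = 0 → M S = 0)
    (hcont : ∀ f : ℕ → Set T, Monotone f → (∀ n, f n ∈ 𝒜) → (⋃ n, f n) ∈ 𝒜 →
      Tendsto (fun n => M (f n) / m (f n)) atTop (𝓝 (M (⋃ n, f n) / m (⋃ n, f n))))
    {A : Set T} (hAA : A ∈ 𝒜) (hA0 : 0 < m A)
    {f : ℕ → Set T} (hf : Monotone f) (hfA : ∀ n, f n ∈ 𝒜) (hUA : (⋃ n, f n) ∈ 𝒜)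
    (hd : Disjoint A (⋃ n, f n)) {b : ℝ} (hb0 : 0 ≤ b) (hbU : b < m (⋃ n, f n))
    (hb : Tendsto (fun n => m (f n)) atTop (𝓝 b)) :
    M A * m (⋃ n, f n) = M (⋃ n, f n) * m A := by
  set B := ⋃ n, f n with hB
  have hU : ⋃ n, (A ∪ f n) = A ∪ B := by rw [hB, union_iUnion]
  have hdn n : Disjoint A (f n) := hd.mono_right (subset_iUnion f n)
  have h1 := hcont f hf hfA hUA
  have h2 := hcont (fun n => A ∪ f n) (fun i j hij => union_subset_union_right A (hf hij))
    (fun n => hA.union_mem hAA (hfA n)) (by rw [hU]; exact hA.union_mem hAA hUA)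
  rw [hU, hmadd A hAA B hUA hd, hMadd A hAA B hUA hd] at h2
  have hMf : Tendsto (fun n => M (f n)) atTop (𝓝 (b * (M B / m B))) := by
    refine (hb.mul h1).congr fun n => ?_
    by_cases h : m (f n) = 0
    · simp [h, hM0 _ (hfA n) h]
    · field_simp
  have h3 : Tendsto (fun n => M (A ∪ f n) / m (A ∪ f n)) atTop
      (𝓝 ((M A + b * (M B / m B)) / (m A + b))) := by
    have : Tendsto (fun n => (M A + M (f n)) / (m A + m (f n))) atTop
        (𝓝 ((M A + b * (M B / m B)) / (m A + b))) :=
      (hMf.const_add _).div (hb.const_add _) (by positivity)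
    refine this.congr fun n => ?_
    rw [hmadd A hAA _ (hfA n) (hdn n), hMadd A hAA _ (hfA n) (hdn n)]
  have h4 := tendsto_nhds_unique h2 h3
  have hB0 : 0 < m B := hb0.trans_lt hbU
  have hs : m A + b ≠ 0 := by positivity
  have hs' : m A + m B ≠ 0 := by positivity
  rw [div_eq_div_iff hs' hs] at h4
  have h5 : M B / m B * m B = M B := div_mul_cancel₀ _ hB0.ne'
  have h6 : (m B - b) * (M A * m B - M B * m A) = 0 := by
    generalize M B / m B = r at h4 h5
    rw [← h5] at h4 ⊢
    linear_combination (-m B) * h4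
  rcases mul_eq_zero.mp h6 with h | h <;> linarith

/-- If the ratio `M / m` is continuous along increasing sequences and not constant, then `m` is
continuous along sequences increasing to the whole space. -/
lemma tendsto_univ_of_ratio_continuous (hA : IsSetAlgebra 𝒜) (hm0 : ∀ S ∈ 𝒜, 0 ≤ m S)
    (hmadd : ∀ S ∈ 𝒜, ∀ S' ∈ 𝒜, Disjoint S S' → m (S ∪ S') = m S + m S')
    (hMadd : ∀ S ∈ 𝒜, ∀ S' ∈ 𝒜, Disjoint S S' → M (S ∪ S') = M S + M S')
    (hM0 : ∀ S ∈ 𝒜, m S = 0 → M S = 0)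
    (hcont : ∀ f : ℕ → Set T, Monotone f → (∀ n, f n ∈ 𝒜) → (⋃ n, f n) ∈ 𝒜 →
      Tendsto (fun n => M (f n) / m (f n)) atTop (𝓝 (M (⋃ n, f n) / m (⋃ n, f n))))
    (hne : ∃ S ∈ 𝒜, M S * m univ ≠ M univ * m S)
    {f : ℕ → Set T} (hf : Monotone f) (hfA : ∀ n, f n ∈ 𝒜) (hU : (⋃ n, f n) = univ) :
    Tendsto (fun n => m (f n)) atTop (𝓝 (m univ)) := by
  obtain ⟨S, hS, hne⟩ := hne
  have hSc := hA.compl_mem hS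
  have key : ∀ A ∈ 𝒜, ∃ b, 0 ≤ b ∧ b ≤ m A ∧
      Tendsto (fun n => m (f n ∩ A)) atTop (𝓝 b) ∧
      (b < m A → 0 < m Aᶜ → M Aᶜ * m A = M A * m Aᶜ) := by
    intro A hAA
    have hgA n : f n ∩ A ∈ 𝒜 := hA.inter_mem (hfA n) hAA
    have hg : Monotone fun n => f n ∩ A := fun i j hij => inter_subset_inter_left A (hf hij)
    have hgU : ⋃ n, f n ∩ A = A := by rw [← iUnion_inter, hU, univ_inter]
    have hle n : m (f n ∩ A) ≤ m A := by
      have hd := hA.isSetRing.sdiff_mem hAA (hfA n)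
      have h := hmadd _ (hgA n) _ hd (disjoint_sdiff_right.mono_left inter_subset_left)
      rw [inter_comm, inter_union_sdiff] at h
      have := hm0 _ hd
      rw [inter_comm]
      linarith
    have hb := tendsto_atTop_ciSup (monotone_comp_of_additive hA hm0 hmadd hg hgA)
      ⟨m A, by rintro _ ⟨n, rfl⟩; exact hle n⟩
    refine ⟨_, ge_of_tendsto' hb fun n => hm0 _ (hgA n), le_of_tendsto' hb hle, hb,
      fun hlt hpos => ?_⟩
    have := ratio_eq_of_mass_loss hA hmadd hMadd hM0 hcont (hA.compl_mem hAA) hpos hg hgA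
      (by rwa [hgU]) (by rw [hgU]; exact disjoint_compl_left)
      (ge_of_tendsto' hb fun n => hm0 _ (hgA n)) (by rwa [hgU]) hb
    rwa [hgU] at this
  obtain ⟨b, hb0, hbS, hb, hb1⟩ := key S hS
  obtain ⟨c, hc0, hcS, hc, hc1⟩ := key Sᶜ hSc
  rw [compl_compl] at hc1
  have hmU : m univ = m S + m Sᶜ := by
    rw [← hmadd _ hS _ hSc disjoint_compl_right, union_compl_self]
  have hMU : M univ = M S + M Sᶜ := by
    rw [← hMadd _ hS _ hSc disjoint_compl_right, union_compl_self]
  rw [hmU, hMU] at hne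
  have hS0 : 0 < m S := (hm0 _ hS).lt_of_ne' fun h => hne (by simp [h, hM0 _ hS h])
  have hSc0 : 0 < m Sᶜ := (hm0 _ hSc).lt_of_ne' fun h => hne (by simp [h, hM0 _ hSc h])
  have hbe : b = m S := hbS.eq_of_not_lt fun h => hne (by linarith [hb1 h hSc0])
  have hce : c = m Sᶜ := hcS.eq_of_not_lt fun h => hne (by linarith [hc1 h hS0])
  rw [hmU, ← hbe, ← hce]
  refine (hb.add hc).congr fun n => ?_
  rw [← hmadd _ (hA.inter_mem (hfA n) hS) _ (hA.inter_mem (hfA n) hSc)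
    (disjoint_compl_right.mono inter_subset_right inter_subset_right), ← inter_union_distrib_left,
    union_compl_self, inter_univ]

end SetAlgebra

/-- A finitely additive set function is additive on pairs. -/
lemma IsWindowSystem.content_union {T : Type*} {𝒲 𝒩 : Set (Set T)} {S S' : Set T}
    {μ : Set T → ℝ≥0∞}
    (hadd : ∀ (n : ℕ) (S : Fin n → Set T), (∀ i, S i ∈ 𝒲 ∪ 𝒩) →
      Pairwise (Function.onFun Disjoint S) → (⋃ i, S i) ∈ 𝒲 ∪ 𝒩 → μ (⋃ i, S i) = ∑ i, μ (S i))
    (hS : S ∈ 𝒲 ∪ 𝒩) (hS' : S' ∈ 𝒲 ∪ 𝒩) (hU : S ∪ S' ∈ 𝒲 ∪ 𝒩) (hd : Disjoint S S') :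
    μ (S ∪ S') = μ S + μ S' := by
  have hUe : ⋃ i, ![S, S'] i = S ∪ S' := by
    ext x; simp [Fin.exists_fin_two]
  have := hadd 2 ![S, S'] (by rw [Fin.forall_fin_two]; exact ⟨hS, hS'⟩)
    (by
      intro i j hij
      fin_cases i <;> fin_cases j <;> simp_all [Function.onFun, disjoint_comm])
    (by rwa [hUe])
  rwa [hUe, Fin.sum_univ_two] at this

/-- A mixture over a disjoint union is additive once weighted by the content. -/
lemma IsWindowSystem.weighted_distribution_union {X T : Type*} [MeasurableSpace X]
    {𝒲 𝒩 : Set (Set T)} {U V : Set T} {μ : Set T → ℝ≥0∞} {𝒟 : Set T → Measure X}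
    (hadd : ∀ (n : ℕ) (S : Fin n → Set T), (∀ i, S i ∈ 𝒲 ∪ 𝒩) →
      Pairwise (Function.onFun Disjoint S) → (⋃ i, S i) ∈ 𝒲 ∪ 𝒩 → μ (⋃ i, S i) = ∑ i, μ (S i))
    (hmix : ∀ (n : ℕ) (W : Fin n → Set T), (∀ i, W i ∈ 𝒲) →
      Pairwise (Function.onFun Disjoint W) → (⋃ i, W i) ∈ 𝒲 →
        𝒟 (⋃ i, W i) = (∑ i, μ (W i))⁻¹ • ∑ i, μ (W i) • 𝒟 (W i))
    (hfin : ∀ S ∈ 𝒲 ∪ 𝒩, μ S < ⊤) (hpos : ∀ W ∈ 𝒲, 0 < μ W)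
    (hU : U ∈ 𝒲) (hV : V ∈ 𝒲) (hUV : U ∪ V ∈ 𝒲) (hd : Disjoint U V) (E : Set X) :
    μ (U ∪ V) * 𝒟 (U ∪ V) E = μ U * 𝒟 U E + μ V * 𝒟 V E := by
  have hUe : ⋃ i, ![U, V] i = U ∪ V := by
    ext x; simp [Fin.exists_fin_two]
  have := hmix 2 ![U, V] (by simp [Fin.forall_fin_two, hU, hV])
    (by
      intro i j hij
      fin_cases i <;> fin_cases j <;> simp_all [Function.onFun, disjoint_comm])
    (by rwa [hUe])
  have hμ := content_union hadd (Or.inl hU) (Or.inl hV) (Or.inl hUV) hd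
  rw [hUe, Fin.sum_univ_two, Fin.sum_univ_two] at this
  simp only [Matrix.cons_val_zero, Matrix.cons_val_one] at this
  rw [← hμ] at this
  rw [this, Measure.smul_apply, Measure.add_apply, Measure.smul_apply, Measure.smul_apply,
    smul_eq_mul, smul_eq_mul, smul_eq_mul, ← mul_assoc,
    ENNReal.mul_inv_cancel (hpos _ hUV).ne' (hfin _ (Or.inl hUV)).ne, one_mul]

namespace IsWindowSystem

variable {X T : Type*} [MeasurableSpace X] [MeasurableSpace T] {𝒲 𝒩 : Set (Set T)}

/-- The filter of sets whose complement is contained in a null window. -/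
def residual (h : IsWindowSystem 𝒲 𝒩) : Filter T :=
  Filter.ofCountableUnion {s | ∃ N ∈ 𝒩, s ⊆ N}
    (by
      intro S hS hSN
      rcases S.eq_empty_or_nonempty with rfl | hne
      · exact ⟨∅, h.empty_mem_null, by simp⟩
      obtain ⟨f, rfl⟩ := hS.exists_eq_range hne
      choose N hN hsub using fun n => hSN (f n) (mem_range_self n)
      exact ⟨_, h.null_iUnion N hN, by rw [sUnion_range]; exact iUnion_mono hsub⟩)
    (fun _ ⟨N, hN, ht⟩ _ hs => ⟨N, hN, hs.trans ht⟩)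

instance (h : IsWindowSystem 𝒲 𝒩) : CountableInterFilter h.residual :=
  Filter.countableInter_ofCountableUnion _ _ _

variable {h : IsWindowSystem 𝒲 𝒩} {S S' U V W : Set T}

lemma mem_residual : S ∈ h.residual ↔ ∃ N ∈ 𝒩, Sᶜ ⊆ N := Iff.rfl

lemma eventuallyEq_empty_of_mem (hS : S ∈ 𝒩) : S =ᶠ[h.residual] (∅ : Set T) := by
  rw [eventuallyEq_set]
  refine mem_residual.2 ⟨S, hS, fun x hx => ?_⟩
  by_contra hxS
  exact hx (by simp [hxS])

lemma mem_null_of_eventuallyEq (hS : MeasurableSet S) (he : S =ᶠ[h.residual] (∅ : Set T)) :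
    S ∈ 𝒩 := by
  rw [eventuallyEq_set] at he
  obtain ⟨N, hN, hsub⟩ := mem_residual.1 he
  exact h.null_mono N hN S hS fun x hx => hsub (by simpa using hx)

lemma not_eventuallyEq_empty (hW : W ∈ 𝒲) : ¬ W =ᶠ[h.residual] (∅ : Set T) := fun he =>
  (h.window_null_disjoint ▸ (⟨hW, mem_null_of_eventuallyEq (h.measurable_window W hW) he⟩ :
    W ∈ 𝒲 ∩ 𝒩) : W ∈ (∅ : Set (Set T)))

lemma diff_eventuallyEq_empty (he : S =ᶠ[h.residual] S') :
    S \ S' =ᶠ[h.residual] (∅ : Set T) := by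
  have := he.diff (EventuallyEq.refl h.residual S')
  rwa [sdiff_self] at this

lemma mem_window_of_not_null (hS : S ∈ 𝒲 ∪ 𝒩) (hne : ¬ S =ᶠ[h.residual] (∅ : Set T)) :
    S ∈ 𝒲 :=
  hS.resolve_right fun hN => hne (eventuallyEq_empty_of_mem hN)

lemma mem_union_of_mem (h : IsWindowSystem 𝒲 𝒩) (hU : U ∈ insert ∅ 𝒲) : U ∈ 𝒲 ∪ 𝒩 := by
  rcases hU with rfl | hU
  exacts [Or.inr h.empty_mem_null, Or.inl hU]

lemma measurableSet_of_mem (h : IsWindowSystem 𝒲 𝒩) (hU : U ∈ 𝒲 ∪ 𝒩) : MeasurableSet U :=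
  hU.elim (h.measurable_window U) (h.measurable_null U)

/-- Up to null windows, a finite disjoint union of members of the semi-ring is a window. -/
lemma exists_subset_biUnion (h : IsWindowSystem 𝒲 𝒩) {n : ℕ} {C : Fin n → Set T}
    (hC : ∀ i, C i ∈ 𝒲 ∪ 𝒩) (hd : Pairwise (Function.onFun Disjoint C)) (I : Finset (Fin n)) :
    ∃ U ∈ insert ∅ 𝒲, U ⊆ ⋃ i ∈ I, C i ∧ U =ᶠ[h.residual] ⋃ i ∈ I, C i := by
  induction I using Finset.induction_on with
  | empty => exact ⟨∅, mem_insert _ _, empty_subset _, by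
      simp only [Finset.notMem_empty, iUnion_of_empty, iUnion_empty]
      exact EventuallyEq.rfl⟩
  | insert a I ha ih =>
    obtain ⟨U, hU, hsub, he⟩ := ih
    rw [Finset.set_biUnion_insert]
    rcases hC a with hW | hN
    · have hdis : Disjoint (C a) U := by
        refine Disjoint.mono_right hsub ?_
        rw [disjoint_iUnion₂_right]
        exact fun i hi => hd (ne_of_mem_of_not_mem hi ha).symm
      refine ⟨C a ∪ U, ?_, union_subset_union_right _ hsub, (EventuallyEq.refl _ _).union he⟩
      rcases hU with rfl | hU
      · simp [hW]
      · exact Or.inr (h.window_disjUnion _ hW _ hU hdis)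
    · refine ⟨U, hU, hsub.trans subset_union_right, ?_⟩
      simpa using (eventuallyEq_empty_of_mem hN).symm.union he

lemma exists_subset_diff (h : IsWindowSystem 𝒲 𝒩) (hU : U ∈ 𝒲 ∪ 𝒩) (hV : V ∈ 𝒲 ∪ 𝒩) :
    ∃ C ∈ insert ∅ 𝒲, C ⊆ U \ V ∧ C =ᶠ[h.residual] (U \ V : Set T) := by
  obtain ⟨n, C, hC, hd, he⟩ := h.diff_eq_disjUnion U hU V hV
  simpa [he] using h.exists_subset_biUnion hC hd Finset.univ

lemma union_mem_insert (h : IsWindowSystem 𝒲 𝒩) (hU : U ∈ insert ∅ 𝒲) (hV : V ∈ insert ∅ 𝒲)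
    (hd : Disjoint U V) : U ∪ V ∈ insert ∅ 𝒲 := by
  rcases hU with rfl | hU
  · simpa using hV
  rcases hV with rfl | hV
  · simp [hU]
  · exact Or.inr (h.window_disjUnion _ hU _ hV hd)

/-- The measurable sets which are null or agree with a window up to null windows. -/
def essWindows (h : IsWindowSystem 𝒲 𝒩) : Set (Set T) :=
  {S | MeasurableSet S ∧ ∃ C ∈ insert ∅ 𝒲, S =ᶠ[h.residual] C}

open Classical in
/-- A window (or the empty set) agreeing with a given set up to null windows. -/
noncomputable def rep (h : IsWindowSystem 𝒲 𝒩) (S : Set T) : Set T :=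
  if hS : S ∈ h.essWindows then hS.2.choose else ∅

lemma rep_mem (h : IsWindowSystem 𝒲 𝒩) (S : Set T) : h.rep S ∈ insert ∅ 𝒲 := by
  unfold rep
  split_ifs with hS
  exacts [hS.2.choose_spec.1, mem_insert _ _]

lemma eventuallyEq_rep (hS : S ∈ h.essWindows) : S =ᶠ[h.residual] h.rep S := by
  rw [rep, dif_pos hS]
  exact hS.2.choose_spec.2

lemma rep_mem_window (hS : S ∈ h.essWindows) (hne : ¬ S =ᶠ[h.residual] (∅ : Set T)) :
    h.rep S ∈ 𝒲 := by
  rcases h.rep_mem S with h0 | hW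
  · exact absurd (h0 ▸ eventuallyEq_rep hS) hne
  · exact hW

lemma rep_eq_empty (he : S =ᶠ[h.residual] (∅ : Set T)) : h.rep S = ∅ := by
  by_cases hS : S ∈ h.essWindows
  · rcases h.rep_mem S with h0 | hW
    · exact h0
    · exact absurd ((eventuallyEq_rep hS).symm.trans he) (not_eventuallyEq_empty hW)
  · rw [rep, dif_neg hS]

lemma subset_essWindows (h : IsWindowSystem 𝒲 𝒩) : 𝒲 ∪ 𝒩 ⊆ h.essWindows := by
  rintro S (hS | hS)
  · exact ⟨h.measurable_window S hS, S, Or.inr hS, EventuallyEq.rfl⟩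
  · exact ⟨h.measurable_null S hS, ∅, mem_insert _ _, eventuallyEq_empty_of_mem hS⟩

/-- Under finite horizon, the sets agreeing with windows up to null windows form an algebra. -/
lemma isSetAlgebra_essWindows (h : IsWindowSystem 𝒲 𝒩) (hfh : HasFiniteHorizon 𝒲 𝒩) :
    IsSetAlgebra h.essWindows where
  empty_mem := ⟨MeasurableSet.empty, ∅, mem_insert _ _, EventuallyEq.rfl⟩
  compl_mem := by
    rintro S ⟨hSm, C, hC, he⟩
    obtain ⟨H, hH, hHc⟩ := hfh
    obtain ⟨C', hC', -, he'⟩ := h.exists_subset_diff (Or.inl hH) (h.mem_union_of_mem hC)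
    refine ⟨hSm.compl, C', hC', ?_⟩
    have hHu : (univ : Set T) =ᶠ[h.residual] H := by
      simpa using (eventuallyEq_empty_of_mem (h := h) hHc).compl.symm
    rw [compl_eq_univ_sdiff]
    exact (hHu.diff he).trans he'.symm
  union_mem := by
    rintro S S' ⟨hSm, C, hC, he⟩ ⟨hSm', C', hC', he'⟩
    obtain ⟨V, hV, hsub, heV⟩ :=
      h.exists_subset_diff (h.mem_union_of_mem hC') (h.mem_union_of_mem hC)
    refine ⟨hSm.union hSm', C ∪ V,
      h.union_mem_insert hC hV (disjoint_sdiff_right.mono_right hsub), ?_⟩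
    have := (EventuallyEq.refl h.residual C).union heV
    rw [union_sdiff_self] at this
    exact (he.union he').trans this.symm

/-- A set function on windows which is additive and invariant under null modifications induces
an additive set function on the essential windows. -/
lemma comp_rep_union {G : Type*} [AddCommMonoid G] {g : Set T → G} (hg0 : g ∅ = 0)
    (hgadd : ∀ W₁ ∈ 𝒲, ∀ W₂ ∈ 𝒲, Disjoint W₁ W₂ → g (W₁ ∪ W₂) = g W₁ + g W₂)
    (hginv : ∀ W₁ ∈ 𝒲, ∀ W₂ ∈ 𝒲, W₁ =ᶠ[h.residual] W₂ → g W₁ = g W₂)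
    (hS : S ∈ h.essWindows) (hS' : S' ∈ h.essWindows) (hd : Disjoint S S') :
    g (h.rep (S ∪ S')) = g (h.rep S) + g (h.rep S') := by
  have hinv : ∀ U ∈ insert ∅ 𝒲, ∀ V ∈ insert ∅ 𝒲, U =ᶠ[h.residual] V → g U = g V := by
    rintro U (rfl | hU) V (rfl | hV) he
    · rfl
    · exact absurd he.symm (not_eventuallyEq_empty hV)
    · exact absurd he (not_eventuallyEq_empty hU)
    · exact hginv U hU V hV he
  have he := eventuallyEq_rep hS
  have he' := eventuallyEq_rep hS'
  obtain ⟨V, hV, hsub, heV⟩ := h.exists_subset_diff (h.mem_union_of_mem (h.rep_mem S'))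
    (h.mem_union_of_mem (h.rep_mem S))
  have hdV : Disjoint (h.rep S) V := disjoint_sdiff_right.mono_right hsub
  have hVS' : V =ᶠ[h.residual] S' := by
    have := heV.trans (he'.symm.diff he.symm)
    rwa [hd.symm.sdiff_eq_left] at this
  have hU : (h.rep S ∪ V : Set T) =ᶠ[h.residual] (S ∪ S' : Set T) := he.symm.union hVS'
  have hmem := h.union_mem_insert (h.rep_mem S) hV hdV
  have hSS' : S ∪ S' ∈ h.essWindows := ⟨hS.1.union hS'.1, _, hmem, hU.symm⟩
  rw [hinv _ (h.rep_mem _) _ hmem ((eventuallyEq_rep hSS').symm.trans hU.symm),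
    hinv _ (h.rep_mem S') _ hV (he'.symm.trans hVS'.symm)]
  rcases h.rep_mem S with h0 | hW
  · simp [h0, hg0]
  rcases hV with rfl | hV
  · simp [hg0]
  · exact hgadd _ hW _ hV hdV

lemma eventuallyEq_univ_of_horizon (hW : Wᶜ ∈ 𝒩) : W =ᶠ[h.residual] (univ : Set T) := by
  simpa using (eventuallyEq_empty_of_mem (h := h) hW).compl

/-- An increasing sequence of essential windows with positive mass is approximated by an
increasing sequence of windows whose union is a window. -/
lemma exists_monotone_windows (h : IsWindowSystem 𝒲 𝒩) {f : ℕ → Set T} (hf : Monotone f)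
    (hfA : ∀ n, f n ∈ h.essWindows) (hU : (⋃ n, f n) ∈ h.essWindows)
    (hne : ∀ n, ¬ f n =ᶠ[h.residual] (∅ : Set T)) :
    ∃ w : ℕ → Set T, Monotone w ∧ (∀ n, w n ∈ 𝒲) ∧ (⋃ n, w n) ∈ 𝒲 ∧
      (∀ n, w n =ᶠ[h.residual] f n) ∧ (⋃ n, w n) =ᶠ[h.residual] ⋃ n, f n := by
  have step : ∀ n V, ∃ V', (V ∈ 𝒲 ∧ V =ᶠ[h.residual] f n) →
      V' ∈ 𝒲 ∧ V ⊆ V' ∧ V' =ᶠ[h.residual] f (n + 1) := by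
    intro n V
    by_cases hV : V ∈ 𝒲 ∧ V =ᶠ[h.residual] f n
    · obtain ⟨hVW, hVe⟩ := hV
      obtain ⟨C, hC, hsub, he⟩ :=
        h.exists_subset_diff (h.mem_union_of_mem (h.rep_mem (f (n + 1)))) (Or.inl hVW)
      have hd : Disjoint V C := disjoint_sdiff_right.mono_right hsub
      refine ⟨V ∪ C, fun _ => ⟨?_, subset_union_left, ?_⟩⟩
      · rcases hC with rfl | hC
        · simpa using hVW
        · exact h.window_disjUnion _ hVW _ hC hd
      · have h1 : C =ᶠ[h.residual] (f (n + 1) \ f n : Set T) :=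
          he.trans ((eventuallyEq_rep (hfA _)).symm.diff hVe)
        have h2 := hVe.union h1
        rwa [union_sdiff_cancel (hf n.le_succ)] at h2
    · exact ⟨∅, fun h' => absurd h' hV⟩
  choose next hnext using step
  let v : ℕ → Set T := fun n => Nat.rec (h.rep (f 0)) next n
  have hv : ∀ n, v n ∈ 𝒲 ∧ v n =ᶠ[h.residual] f n := by
    intro n
    induction n with
    | zero => exact ⟨rep_mem_window (hfA 0) (hne 0), (eventuallyEq_rep (hfA 0)).symm⟩
    | succ n ih => exact ⟨(hnext n (v n) ih).1, (hnext n (v n) ih).2.2⟩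
  have hvm : Monotone v := monotone_nat_of_le_succ fun n => (hnext n (v n) (hv n)).2.1
  have hvU : (⋃ n, v n) =ᶠ[h.residual] ⋃ n, f n :=
    Filter.EventuallyEq.countable_iUnion fun n => (hv n).2
  have hneU : ¬ (⋃ n, f n) =ᶠ[h.residual] (∅ : Set T) := fun he => hne 0 <| by
    simpa [inter_eq_self_of_subset_left (subset_iUnion f 0)] using
      (EventuallyEq.refl h.residual (f 0)).inter he
  have hW := rep_mem_window hU hneU
  have hWe := eventuallyEq_rep hU
  have hN : h.rep (⋃ n, f n) \ (⋃ n, v n) ∈ 𝒩 :=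
    mem_null_of_eventuallyEq ((h.measurable_window _ hW).diff
      (.iUnion fun n => h.measurable_window _ (hv n).1))
      (diff_eventuallyEq_empty (hWe.symm.trans hvU.symm))
  obtain ⟨C, hC, hsub, he⟩ := h.exists_subset_diff (Or.inl hW) (Or.inr hN)
  rw [sdiff_sdiff_right_self] at hsub he
  have hCe : C =ᶠ[h.residual] ⋃ n, f n := by
    simpa using he.trans (hWe.symm.inter hvU)
  have hCU : ⋃ n, v n ∩ C = C := by
    rw [← iUnion_inter]
    exact inter_eq_self_of_subset_right fun x hx => (hsub hx).2
  have hCW : C ∈ 𝒲 := hC.resolve_left fun h0 => hneU (h0 ▸ hCe.symm)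
  have hve n : (v n ∩ C : Set T) =ᶠ[h.residual] f n := by
    simpa [inter_eq_self_of_subset_left (subset_iUnion f n)] using (hv n).2.inter hCe
  refine ⟨fun n => v n ∩ C, fun i j hij => inter_subset_inter_left C (hvm hij), fun n => ?_,
    by rwa [hCU], hve, by rwa [hCU]⟩
  exact mem_window_of_not_null (h.inter_mem _ (Or.inl (hv n).1) _ (Or.inl hCW))
    fun h0 => hne n ((hve n).symm.trans h0)

section Content

variable {μ : Set T → ℝ≥0∞} {𝒟 : Set T → Measure X}

lemma content_eq_of_eventuallyEq
    (hadd : ∀ (n : ℕ) (S : Fin n → Set T), (∀ i, S i ∈ 𝒲 ∪ 𝒩) →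
      Pairwise (Function.onFun Disjoint S) → (⋃ i, S i) ∈ 𝒲 ∪ 𝒩 → μ (⋃ i, S i) = ∑ i, μ (S i))
    (hnull : ∀ N ∈ 𝒩, μ N = 0)
    (hS : S ∈ 𝒲 ∪ 𝒩) (hS' : S' ∈ 𝒲 ∪ 𝒩) (he : S =ᶠ[h.residual] S') : μ S = μ S' := by
  have key : ∀ A ∈ 𝒲 ∪ 𝒩, ∀ B ∈ 𝒲 ∪ 𝒩, A =ᶠ[h.residual] B → μ A = μ (A ∩ B) := by
    intro A hA B hB he
    have hN : A \ B ∈ 𝒩 := mem_null_of_eventuallyEq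
      ((h.measurableSet_of_mem hA).diff (h.measurableSet_of_mem hB)) (diff_eventuallyEq_empty he)
    have := content_union hadd (h.inter_mem A hA B hB) (Or.inr hN)
      (by rwa [inter_union_sdiff]) (disjoint_sdiff_right.mono_left inter_subset_right)
    rwa [inter_union_sdiff, hnull _ hN, add_zero] at this
  rw [key S hS S' hS' he, key S' hS' S hS he.symm, inter_comm]

lemma distribution_eq_of_eventuallyEq (hWDS : IsWDS 𝒲 𝒩 𝒟) (hU : U ∈ 𝒲) (hV : V ∈ 𝒲)
    (he : U =ᶠ[h.residual] V) : 𝒟 U = 𝒟 V := by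
  have hUm := h.measurable_window U hU
  have hVm := h.measurable_window V hV
  refine hWDS.null_invariant U hU V hV (mem_null_of_eventuallyEq (h := h) (hUm.symmDiff hVm) ?_)
  have := (diff_eventuallyEq_empty he).union (diff_eventuallyEq_empty he.symm)
  rwa [union_empty] at this

/-- The ratio of the weighted distributions to the weights is continuous along increasing
sequences of essential windows. -/
lemma tendsto_weighted_ratio (hWDS : IsWDS 𝒲 𝒩 𝒟)
    (hfin : ∀ S ∈ 𝒲 ∪ 𝒩, μ S < ⊤) (hpos : ∀ W ∈ 𝒲, 0 < μ W) (hμ0 : μ ∅ = 0)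
    {E : Set X} (hE : MeasurableSet E) {f : ℕ → Set T} (hf : Monotone f)
    (hfA : ∀ n, f n ∈ h.essWindows) (hU : (⋃ n, f n) ∈ h.essWindows) :
    Tendsto (fun n => (μ (h.rep (f n)) * 𝒟 (h.rep (f n)) E).toReal / (μ (h.rep (f n))).toReal)
      atTop (𝓝 ((μ (h.rep (⋃ n, f n)) * 𝒟 (h.rep (⋃ n, f n)) E).toReal /
        (μ (h.rep (⋃ n, f n))).toReal)) := by
  have hratio : ∀ S ∈ h.essWindows, ∀ W ∈ 𝒲, W =ᶠ[h.residual] S →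
      (μ (h.rep S) * 𝒟 (h.rep S) E).toReal / (μ (h.rep S)).toReal = (𝒟 W E).toReal := by
    intro S hS W hW he
    have hr : h.rep S ∈ 𝒲 :=
      rep_mem_window hS fun h0 => not_eventuallyEq_empty hW (he.trans h0)
    rw [distribution_eq_of_eventuallyEq hWDS hW hr (he.trans (eventuallyEq_rep hS)),
      ENNReal.toReal_mul, mul_div_cancel_left₀]
    exact (ENNReal.toReal_pos (hpos _ hr).ne' (hfin _ (Or.inl hr)).ne).ne'
  by_cases h0 : ∀ n, f n =ᶠ[h.residual] (∅ : Set T)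
  · have hU0 : (⋃ n, f n) =ᶠ[h.residual] (∅ : Set T) := by
      have := Filter.EventuallyEq.countable_iUnion h0
      rwa [iUnion_empty] at this
    simp [rep_eq_empty hU0, rep_eq_empty (h0 _), hμ0]
  push Not at h0
  obtain ⟨k, hk⟩ := h0
  have hsh : ⋃ n, f (n + k) = ⋃ n, f n := hf.iUnion_nat_add k
  obtain ⟨w, hw, hwW, hwU, hwe, hwUe⟩ := h.exists_monotone_windows
    (f := fun n => f (n + k)) (fun i j hij => hf (by lia)) (fun n => hfA _) (by rwa [hsh])
    (fun n h0 => hk <| by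
      have := (EventuallyEq.refl h.residual (f k)).inter h0
      rwa [inter_eq_self_of_subset_left (hf (Nat.le_add_left k n)), inter_empty] at this)
  rw [hsh] at hwUe
  rw [← tendsto_add_atTop_iff_nat k, hratio _ hU _ hwU hwUe]
  have := hWDS.prob _ hwU
  refine ((ENNReal.tendsto_toReal (measure_ne_top _ _)).comp
    (hWDS.continuous w hw hwW hwU E hE)).congr fun n => ?_
  exact (hratio _ (hfA _) _ (hwW n) (hwe n)).symm

end Content

/-- Under finite horizon the windows and null windows generate the whole σ-algebra. -/
lemma generateFrom_eq {T : Type*} [mT : MeasurableSpace T] {𝒲 𝒩 : Set (Set T)}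
    (h : IsWindowSystem 𝒲 𝒩) (hfh : HasFiniteHorizon 𝒲 𝒩) :
    mT = MeasurableSpace.generateFrom (𝒲 ∪ 𝒩) := by
  refine le_antisymm (fun S hS => ?_)
    (MeasurableSpace.generateFrom_le fun S hS => h.measurableSet_of_mem hS)
  obtain ⟨H, hH, hHc⟩ := hfh
  rw [← inter_union_sdiff S H]
  refine MeasurableSet.union (h.locally_generates H hH S hS)
    (MeasurableSpace.measurableSet_generateFrom (Or.inr ?_))
  exact h.null_mono _ hHc _ (hS.diff (h.measurable_window H hH)) fun x hx => hx.2

end IsWindowSystem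

/-- Let `(𝒲, 𝒩, 𝒟)` be a non-constant windowed distribution system with
finite horizon. Every finite, finitely additive set function `μ` on the semi-ring `𝒲 ∪ 𝒩`
satisfying the compatibility conditions (`0 < μ W < ∞` for `W ∈ 𝒲`, `μ N = 0` for `N ∈ 𝒩`,
and the convex-mixture condition for disjoint windows whose union is a window) is
σ-additive on `𝒲 ∪ 𝒩` and extends uniquely to a measure on `Σ_T` compatible with the
WDS. -/
theorem content_compatible_is_premeasure_and_extends
    {X T : Type*} [MeasurableSpace X] [MeasurableSpace T]
    (𝒲 𝒩 : Set (Set T)) (𝒟 : Set T → Measure X)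
    (hWS : IsWindowSystem 𝒲 𝒩) (hWDS : IsWDS 𝒲 𝒩 𝒟)
    (hfh : ∃ W ∈ 𝒲, Wᶜ ∈ 𝒩)
    (hnc : ¬ IsConstantWDS 𝒲 𝒟)
    (μ : Set T → ℝ≥0∞)
    (hfin : ∀ S ∈ 𝒲 ∪ 𝒩, μ S < ⊤)
    (hadd : ∀ (n : ℕ) (S : Fin n → Set T), (∀ i, S i ∈ 𝒲 ∪ 𝒩) →
      Pairwise (Function.onFun Disjoint S) → (⋃ i, S i) ∈ 𝒲 ∪ 𝒩 →
        μ (⋃ i, S i) = ∑ i, μ (S i))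
    (hpos : ∀ W ∈ 𝒲, 0 < μ W)
    (hnull : ∀ N ∈ 𝒩, μ N = 0)
    (hmix : ∀ (n : ℕ) (W : Fin n → Set T), (∀ i, W i ∈ 𝒲) →
      Pairwise (Function.onFun Disjoint W) → (⋃ i, W i) ∈ 𝒲 →
        𝒟 (⋃ i, W i) = (∑ i, μ (W i))⁻¹ • ∑ i, μ (W i) • 𝒟 (W i)) :
    (∀ f : ℕ → Set T, (∀ n, f n ∈ 𝒲 ∪ 𝒩) → Pairwise (Function.onFun Disjoint f) →
      (⋃ n, f n) ∈ 𝒲 ∪ 𝒩 → μ (⋃ n, f n) = ∑' n, μ (f n)) ∧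
    (∃! P : Measure T, (∀ S ∈ 𝒲 ∪ 𝒩, P S = μ S) ∧
      IsCompatibleTimeDistribution 𝒲 𝒩 𝒟 P) := by
  have hfh' : HasFiniteHorizon 𝒲 𝒩 := hfh
  have hA := hWS.isSetAlgebra_essWindows hfh'
  have hμ0 : μ ∅ = 0 := hnull ∅ hWS.empty_mem_null
  have hadd' : ∀ S ∈ hWS.essWindows, ∀ S' ∈ hWS.essWindows, Disjoint S S' →
      μ (hWS.rep (S ∪ S')) = μ (hWS.rep S) + μ (hWS.rep S') := fun S hS S' hS' hd =>
    IsWindowSystem.comp_rep_union hμ0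
      (fun U hU V hV hd => IsWindowSystem.content_union hadd (Or.inl hU) (Or.inl hV)
        (Or.inl (hWS.window_disjUnion U hU V hV hd)) hd)
      (fun U hU V hV he => IsWindowSystem.content_eq_of_eventuallyEq hadd hnull (Or.inl hU)
        (Or.inl hV) he) hS hS' hd
  have hrepfin S : μ (hWS.rep S) ≠ ⊤ := (hfin _ (hWS.mem_union_of_mem (hWS.rep_mem S))).ne
  have hrep : ∀ S ∈ 𝒲 ∪ 𝒩, μ (hWS.rep S) = μ S := fun S hS =>
    (IsWindowSystem.content_eq_of_eventuallyEq hadd hnull hS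
      (hWS.mem_union_of_mem (hWS.rep_mem S))
      (IsWindowSystem.eventuallyEq_rep (hWS.subset_essWindows hS))).symm
  have hcont : ∀ f : ℕ → Set T, Monotone f → (∀ n, f n ∈ hWS.essWindows) → (⋃ n, f n) = univ →
      Tendsto (fun n => (μ (hWS.rep (f n))).toReal) atTop (𝓝 (μ (hWS.rep univ)).toReal) := by
    intro f hf hfA hfU
    simp only [IsConstantWDS, not_forall] at hnc
    obtain ⟨W₁, hW₁, W₂, hW₂, hne⟩ := hnc
    obtain ⟨E, hE, hne⟩ : ∃ E, MeasurableSet E ∧ 𝒟 W₁ E ≠ 𝒟 W₂ E := by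
      by_contra! hc
      exact hne (Measure.ext hc)
    have hMfin S : μ (hWS.rep S) * 𝒟 (hWS.rep S) E ≠ ⊤ := by
      rcases hWS.rep_mem S with h0 | hW
      · simp [h0, hμ0]
      · have := hWDS.prob _ hW
        exact ENNReal.mul_ne_top (hrepfin S) (measure_ne_top _ _)
    have hval : ∀ W ∈ 𝒲, (μ (hWS.rep W) * 𝒟 (hWS.rep W) E).toReal =
        (𝒟 W E).toReal * (μ W).toReal := by
      intro W hW
      have hWA := hWS.subset_essWindows (Or.inl hW)
      rw [hrep W (Or.inl hW), IsWindowSystem.distribution_eq_of_eventuallyEq hWDS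
        (IsWindowSystem.rep_mem_window hWA (IsWindowSystem.not_eventuallyEq_empty hW)) hW
        (IsWindowSystem.eventuallyEq_rep hWA).symm, ENNReal.toReal_mul, mul_comm]
    refine tendsto_univ_of_ratio_continuous (M := fun S =>
      (μ (hWS.rep S) * 𝒟 (hWS.rep S) E).toReal) (m := fun S => (μ (hWS.rep S)).toReal)
      hA (fun _ _ => ENNReal.toReal_nonneg)
      (fun S hS S' hS' hd => ?_) (fun S hS S' hS' hd => ?_) (fun S hS h0 => ?_)
      (fun g hg hgA hgU => IsWindowSystem.tendsto_weighted_ratio hWDS hfin hpos hμ0 hE hg hgA hgU)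
      ?_ hf hfA hfU
    · rw [hadd' S hS S' hS' hd, ENNReal.toReal_add (hrepfin _) (hrepfin _)]
    · rw [← ENNReal.toReal_add (hMfin _) (hMfin _)]
      congr 1
      exact IsWindowSystem.comp_rep_union (g := fun S => μ S * 𝒟 S E) (by simp [hμ0])
        (fun U hU V hV hd => IsWindowSystem.weighted_distribution_union hadd hmix hfin hpos hU hV
          (hWS.window_disjUnion U hU V hV hd) hd E)
        (fun U hU V hV he => by
          simp only [IsWindowSystem.content_eq_of_eventuallyEq hadd hnull (Or.inl hU)
            (Or.inl hV) he, IsWindowSystem.distribution_eq_of_eventuallyEq hWDS hU hV he])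
        hS hS' hd
    · rw [ENNReal.toReal_mul, h0, zero_mul]
    · by_contra! hc
      have hu : (μ (hWS.rep univ)).toReal ≠ 0 := by
        intro hu0
        obtain ⟨H, hH, hHc⟩ := hfh
        have hr := IsWindowSystem.rep_mem_window hA.univ_mem fun h0 =>
          IsWindowSystem.not_eventuallyEq_empty hH
            ((IsWindowSystem.eventuallyEq_univ_of_horizon (h := hWS) hHc).trans h0)
        exact (ENNReal.toReal_pos (hpos _ hr).ne' (hrepfin univ)).ne' hu0
      have hall : ∀ W ∈ 𝒲, (𝒟 W E).toReal =
          (μ (hWS.rep univ) * 𝒟 (hWS.rep univ) E).toReal / (μ (hWS.rep univ)).toReal := by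
        intro W hW
        have h1 := hc W (hWS.subset_essWindows (Or.inl hW))
        rw [hval W hW, hrep W (Or.inl hW)] at h1
        have h2 : (μ W).toReal ≠ 0 :=
          (ENNReal.toReal_pos (hpos W hW).ne' (hfin W (Or.inl hW)).ne).ne'
        rw [eq_div_iff hu]
        apply mul_right_cancel₀ h2
        linear_combination h1
      have := hWDS.prob _ hW₁
      have := hWDS.prob _ hW₂
      exact hne ((ENNReal.toReal_eq_toReal_iff' (measure_ne_top _ _) (measure_ne_top _ _)).1
        ((hall W₁ hW₁).trans (hall W₂ hW₂).symm))
  let m : AddContent ℝ≥0∞ hWS.essWindows :=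
    hA.isSetRing.addContent_of_union (fun S => μ (hWS.rep S))
      (by simp only [IsWindowSystem.rep_eq_empty (h := hWS) EventuallyEq.rfl, hμ0])
      (fun hS hS' hd => hadd' _ hS _ hS' hd)
  have hm S : m S = μ (hWS.rep S) := rfl
  have hzero : ∀ ⦃s : ℕ → Set T⦄, (∀ n, s n ∈ hWS.essWindows) → Antitone s →
      (⋂ n, s n) = ∅ → Tendsto (fun n => m (s n)) atTop (𝓝 0) := by
    intro s hs hanti hinter
    have h1 := hcont (fun n => (s n)ᶜ) (fun i j hij => compl_subset_compl.2 (hanti hij))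
      (fun n => hA.compl_mem (hs n)) (by rw [← compl_iInter, hinter, compl_empty])
    rw [← ENNReal.tendsto_toReal_iff (f := fun n => m (s n)) (fun n => hrepfin _) ENNReal.zero_ne_top]
    have h2 := h1.const_sub (μ (hWS.rep univ)).toReal
    rw [sub_self] at h2
    refine h2.congr fun n => ?_
    rw [hm, ← union_compl_self (s n), hadd' _ (hs n) _ (hA.compl_mem (hs n)) disjoint_compl_right,
      ENNReal.toReal_add (hrepfin _) (hrepfin _), add_sub_cancel_right]
  have hsub : m.IsSigmaSubadditive :=
    isSigmaSubadditive_of_addContent_iUnion_eq_tsum hA.isSetRing fun f hf hfU hd =>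
      addContent_iUnion_eq_sum_of_tendsto_zero hA.isSetRing m (fun S _ => hrepfin S) hzero hf hfU hd
  have hgen : ‹MeasurableSpace T› = MeasurableSpace.generateFrom (𝒲 ∪ 𝒩) :=
    hWS.generateFrom_eq hfh'
  have hgen' : ‹MeasurableSpace T› = MeasurableSpace.generateFrom hWS.essWindows :=
    le_antisymm (hgen.le.trans (MeasurableSpace.generateFrom_mono hWS.subset_essWindows))
      (MeasurableSpace.generateFrom_le fun S hS => hS.1)
  let P : Measure T := m.measure hA.isSetRing.isSetSemiring hgen'.le hsub
  have hP : ∀ S ∈ 𝒲 ∪ 𝒩, P S = μ S := fun S hS =>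
    (m.measure_eq hA.isSetRing.isSetSemiring hgen' hsub (hWS.subset_essWindows hS)).trans
      (hrep S hS)
  refine ⟨fun f hf hd hU => ?_, P, ⟨hP, fun W hW => ?_, fun N hN => ?_, fun n W hW hd hU => ?_⟩,
    ?_⟩
  · rw [← hP _ hU, measure_iUnion hd fun n => hWS.measurableSet_of_mem (hf n)]
    exact tsum_congr fun n => hP _ (hf n)
  · rw [hP W (Or.inl hW)]
    exact ⟨hpos W hW, hfin W (Or.inl hW)⟩
  · rw [hP N (Or.inr hN), hnull N hN]
  · simpa only [hP _ (Or.inl (hW _))] using hmix n W hW hd hU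
  · rintro Q ⟨hQ, -⟩
    obtain ⟨H, hH, hHc⟩ := hfh
    have huniv : ∀ R : Measure T, (∀ S ∈ 𝒲 ∪ 𝒩, R S = μ S) → R univ = μ H := by
      intro R hR
      rw [← measure_add_measure_compl (hWS.measurable_window H hH), hR _ (Or.inl hH),
        hR _ (Or.inr hHc), hnull _ hHc, add_zero]
    have : IsFiniteMeasure Q := ⟨by rw [huniv Q hQ]; exact hfin H (Or.inl hH)⟩
    exact ext_of_generate_finite (𝒲 ∪ 𝒩) hgen (fun A hA B hB _ => hWS.inter_mem A hA B hB)
      (fun S hS => (hQ S hS).trans (hP S hS).symm) ((huniv Q hQ).trans (huniv P hP).symm)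
end

section
/- Let (W, N, (D_W)) be a non-constant windowed distribution system with finite horizon on X over (T, Σ_T). Then there exists a unique probability measure P_T on Σ_T that is compatible with the WDS. -/
open MeasureTheory Set Filter Topology
open scoped ENNReal

/-- The sets which, up to a null window, are either empty or a window contained in them. -/
def windowAlgebra {T : Type*} (𝒲 𝒩 : Set (Set T)) : Set (Set T) :=
  {S | S ∈ 𝒩 ∨ ∃ W ∈ 𝒲, W ⊆ S ∧ S \ W ∈ 𝒩}

namespace IsWindowSystem

variable {T : Type*} [MeasurableSpace T] {𝒲 𝒩 : Set (Set T)}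

lemma notMem_null (h : IsWindowSystem 𝒲 𝒩) {W : Set T} (hW : W ∈ 𝒲) : W ∉ 𝒩 := fun hN ↦ by
  have : W ∈ 𝒲 ∩ 𝒩 := ⟨hW, hN⟩
  rw [h.window_null_disjoint] at this
  exact this

lemma null_union (h : IsWindowSystem 𝒲 𝒩) {A B : Set T} (hA : A ∈ 𝒩) (hB : B ∈ 𝒩) :
    A ∪ B ∈ 𝒩 := by
  have := h.null_iUnion (fun n ↦ if n = 0 then A else B) (fun n ↦ by
    split_ifs <;> assumption)
  refine h.null_mono _ this _ ((h.measurable_null _ hA).union (h.measurable_null _ hB)) ?_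
  rintro x (hx | hx)
  · exact mem_iUnion.2 ⟨0, by simpa using hx⟩
  · exact mem_iUnion.2 ⟨1, by simpa using hx⟩

lemma window_subset_windowAlgebra (h : IsWindowSystem 𝒲 𝒩) : 𝒲 ⊆ windowAlgebra 𝒲 𝒩 :=
  fun W hW ↦ Or.inr ⟨W, hW, subset_rfl, by simpa using h.empty_mem_null⟩

lemma union_subset_windowAlgebra (h : IsWindowSystem 𝒲 𝒩) : 𝒲 ∪ 𝒩 ⊆ windowAlgebra 𝒲 𝒩 :=
  union_subset h.window_subset_windowAlgebra fun _ ↦ Or.inl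

lemma measurableSet_of_mem_windowAlgebra (h : IsWindowSystem 𝒲 𝒩) {S : Set T}
    (hS : S ∈ windowAlgebra 𝒲 𝒩) : MeasurableSet S := by
  rcases hS with hS | ⟨W, hW, hWS, hN⟩
  · exact h.measurable_null _ hS
  · rw [← union_sdiff_cancel hWS]
    exact (h.measurable_window _ hW).union (h.measurable_null _ hN)

lemma windowAlgebra_disjUnion (h : IsWindowSystem 𝒲 𝒩) {A B : Set T}
    (hA : A ∈ windowAlgebra 𝒲 𝒩) (hB : B ∈ windowAlgebra 𝒲 𝒩) (hAB : Disjoint A B) :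
    A ∪ B ∈ windowAlgebra 𝒲 𝒩 := by
  have mA := h.measurableSet_of_mem_windowAlgebra hA
  have mB := h.measurableSet_of_mem_windowAlgebra hB
  rcases hA with hA | ⟨V, hV, hVA, hVN⟩ <;> rcases hB with hB | ⟨W, hW, hWB, hWN⟩
  · exact Or.inl (h.null_union hA hB)
  · refine Or.inr ⟨W, hW, hWB.trans subset_union_right, ?_⟩
    refine h.null_mono _ (h.null_union hA hWN) _
      ((mA.union mB).diff (h.measurable_window _ hW)) ?_
    grind
  · refine Or.inr ⟨V, hV, hVA.trans subset_union_left, ?_⟩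
    refine h.null_mono _ (h.null_union hVN hB) _
      ((mA.union mB).diff (h.measurable_window _ hV)) ?_
    grind
  · have hU := h.window_disjUnion _ hV _ hW (hAB.mono hVA hWB)
    refine Or.inr ⟨_, hU, union_subset_union hVA hWB, ?_⟩
    refine h.null_mono _ (h.null_union hVN hWN) _
      ((mA.union mB).diff (h.measurable_window _ hU)) ?_
    grind

lemma windowAlgebra_biUnion (h : IsWindowSystem 𝒲 𝒩) {ι : Type*} {C : ι → Set T}
    (hC : ∀ i, C i ∈ windowAlgebra 𝒲 𝒩) (hd : Pairwise (Function.onFun Disjoint C))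
    (s : Finset ι) : ⋃ i ∈ s, C i ∈ windowAlgebra 𝒲 𝒩 := by
  classical
  induction s using Finset.induction_on with
  | empty => simpa using h.union_subset_windowAlgebra (Or.inr h.empty_mem_null)
  | insert a s ha ih =>
    rw [Finset.set_biUnion_insert]
    refine h.windowAlgebra_disjUnion (hC a) ih ?_
    simp only [disjoint_iUnion_right]
    intro i hi
    exact hd (by rintro rfl; exact ha hi)

lemma sdiff_mem_windowAlgebra (h : IsWindowSystem 𝒲 𝒩) {A B : Set T}
    (hA : A ∈ 𝒲 ∪ 𝒩) (hB : B ∈ 𝒲 ∪ 𝒩) : A \ B ∈ windowAlgebra 𝒲 𝒩 := by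
  obtain ⟨n, C, hC, hd, he⟩ := h.diff_eq_disjUnion A hA B hB
  rw [he]
  simpa using h.windowAlgebra_biUnion (fun i ↦ h.union_subset_windowAlgebra (hC i)) hd Finset.univ

/-- The algebra is invariant under modification by null windows. -/
lemma windowAlgebra_of_sdiff (h : IsWindowSystem 𝒲 𝒩) {S S' : Set T}
    (hS : S ∈ windowAlgebra 𝒲 𝒩) (mS' : MeasurableSet S') (h₁ : S \ S' ∈ 𝒩) (h₂ : S' \ S ∈ 𝒩) :
    S' ∈ windowAlgebra 𝒲 𝒩 := by
  rcases hS with hS | ⟨W, hW, hWS, hN⟩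
  · refine Or.inl (h.null_mono _ (h.null_union hS h₂) _ mS' ?_)
    grind
  · have mW := h.measurable_window _ hW
    have hWS' : W \ S' ∈ 𝒩 := h.null_mono _ h₁ _ (mW.diff mS') (by grind)
    have key := h.sdiff_mem_windowAlgebra (Or.inl hW) (Or.inr hWS')
    have e : W \ (W \ S') = W ∩ S' := by grind
    rw [e] at key
    rcases key with key | ⟨V, hV, hVS, hVN⟩
    · refine absurd (h.null_mono _ (h.null_union key hWS') W mW ?_) (h.notMem_null hW)
      grind
    · refine Or.inr ⟨V, hV, hVS.trans inter_subset_right, ?_⟩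
      refine h.null_mono _ (h.null_union (h.null_union h₂ hN) hVN) _
        (mS'.diff (h.measurable_window _ hV)) ?_
      grind

lemma isSetAlgebra_windowAlgebra (h : IsWindowSystem 𝒲 𝒩) {Ω : Set T} (hΩ : Ω ∈ 𝒲)
    (hΩc : Ωᶜ ∈ 𝒩) : IsSetAlgebra (windowAlgebra 𝒲 𝒩) := by
  have hnull : ∀ {S N : Set T}, N ∈ 𝒩 → MeasurableSet S → S ⊆ N → S ∈ 𝒩 :=
    fun hN hS hSN ↦ h.null_mono _ hN _ hS hSN
  have hcompl : ∀ ⦃S⦄, S ∈ windowAlgebra 𝒲 𝒩 → Sᶜ ∈ windowAlgebra 𝒲 𝒩 := by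
    intro S hS
    have mS := h.measurableSet_of_mem_windowAlgebra hS
    have mΩ := h.measurable_window _ hΩ
    rcases hS with hS | ⟨W, hW, hWS, hN⟩
    · refine h.windowAlgebra_of_sdiff (h.window_subset_windowAlgebra hΩ) mS.compl ?_ ?_
      · exact hnull hS (mΩ.diff mS.compl) (by grind)
      · exact hnull hΩc (mS.compl.diff mΩ) (by grind)
    · have mW := h.measurable_window _ hW
      refine h.windowAlgebra_of_sdiff
        (h.sdiff_mem_windowAlgebra (Or.inl hΩ) (Or.inl hW)) mS.compl ?_ ?_
      · exact hnull hN ((mΩ.diff mW).diff mS.compl) (by grind)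
      · exact hnull hΩc (mS.compl.diff (mΩ.diff mW)) (by intro x; simp; grind)
  have hinter : ∀ ⦃S S'⦄, S ∈ windowAlgebra 𝒲 𝒩 → S' ∈ windowAlgebra 𝒲 𝒩 →
      S ∩ S' ∈ windowAlgebra 𝒲 𝒩 := by
    intro S S' hS hS'
    have mS := h.measurableSet_of_mem_windowAlgebra hS
    have mS' := h.measurableSet_of_mem_windowAlgebra hS'
    rcases hS with hS | ⟨W, hW, hWS, hN⟩
    · exact Or.inl (hnull hS (mS.inter mS') inter_subset_left)
    rcases hS' with hS' | ⟨W', hW', hWS', hN'⟩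
    · exact Or.inl (hnull hS' (mS.inter mS') inter_subset_right)
    have mW := h.measurable_window _ hW
    have mW' := h.measurable_window _ hW'
    refine h.windowAlgebra_of_sdiff (h.union_subset_windowAlgebra
      (h.inter_mem _ (Or.inl hW) _ (Or.inl hW'))) (mS.inter mS') ?_ ?_
    · exact hnull h.empty_mem_null ((mW.inter mW').diff (mS.inter mS')) (by grind)
    · exact hnull (h.null_union hN hN') ((mS.inter mS').diff (mW.inter mW')) (by grind)
  refine ⟨Or.inl h.empty_mem_null, hcompl, fun S S' hS hS' ↦ ?_⟩
  have := hcompl (hinter (hcompl hS) (hcompl hS'))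
  rwa [compl_inter, compl_compl, compl_compl] at this

lemma generateFrom_windowAlgebra (h : IsWindowSystem 𝒲 𝒩) {Ω : Set T} (hΩ : Ω ∈ 𝒲)
    (hΩc : Ωᶜ ∈ 𝒩) :
    ‹MeasurableSpace T› = MeasurableSpace.generateFrom (windowAlgebra 𝒲 𝒩) := by
  refine le_antisymm (fun S mS ↦ ?_)
    (MeasurableSpace.generateFrom_le fun S hS ↦ h.measurableSet_of_mem_windowAlgebra hS)
  have h₁ := MeasurableSpace.generateFrom_mono h.union_subset_windowAlgebra _
    (h.locally_generates Ω hΩ S mS)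
  have h₂ : MeasurableSet[MeasurableSpace.generateFrom (windowAlgebra 𝒲 𝒩)] (S \ Ω) :=
    MeasurableSpace.measurableSet_generateFrom <| Or.inl <|
      h.null_mono _ hΩc _ (mS.diff (h.measurable_window _ hΩ)) (by intro x hx; exact hx.2)
  rw [← inter_union_sdiff S Ω]
  exact MeasurableSet.union h₁ h₂

end IsWindowSystem

section Extension

variable {X T : Type*} [MeasurableSpace X] [MeasurableSpace T] {𝒲 𝒩 : Set (Set T)}
  {𝒟 : Set T → Measure X}

lemma IsWindowSystem.null_biUnion (h : IsWindowSystem 𝒲 𝒩) {ι : Type*} {N : ι → Set T}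
    (hN : ∀ i, N i ∈ 𝒩) (s : Finset ι) : ⋃ i ∈ s, N i ∈ 𝒩 := by
  classical
  induction s using Finset.induction_on with
  | empty => simpa using h.empty_mem_null
  | insert a s ha ih =>
    rw [Finset.set_biUnion_insert]
    exact h.null_union (hN a) ih

lemma IsWindowSystem.window_biUnion (h : IsWindowSystem 𝒲 𝒩) {ι : Type*} {C : ι → Set T}
    (hC : ∀ i, C i ∈ 𝒲) (hd : Pairwise (Function.onFun Disjoint C))
    {s : Finset ι} (hs : s.Nonempty) : ⋃ i ∈ s, C i ∈ 𝒲 := by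
  classical
  induction hs using Finset.Nonempty.cons_induction with
  | singleton a => simpa using hC a
  | cons a s ha hs ih =>
    rw [Finset.cons_eq_insert, Finset.set_biUnion_insert]
    refine h.window_disjUnion _ (hC a) _ ih ?_
    simp only [disjoint_iUnion_right]
    intro i hi
    exact hd (by rintro rfl; exact ha hi)

open Classical in
/-- The extension of the window distributions to the window algebra, with value `0` on null
windows. -/
noncomputable def windowDistribution (𝒲 𝒩 : Set (Set T)) (𝒟 : Set T → Measure X) (S : Set T) :
    Measure X :=
  if h : ∃ W ∈ 𝒲, W ⊆ S ∧ S \ W ∈ 𝒩 then 𝒟 h.choose else 0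

lemma IsWDS.windowDistribution_eq (hD : IsWDS 𝒲 𝒩 𝒟) (h : IsWindowSystem 𝒲 𝒩) {S W : Set T}
    (hW : W ∈ 𝒲) (hWS : W ⊆ S) (hSW : S \ W ∈ 𝒩) : windowDistribution 𝒲 𝒩 𝒟 S = 𝒟 W := by
  have hex : ∃ W ∈ 𝒲, W ⊆ S ∧ S \ W ∈ 𝒩 := ⟨W, hW, hWS, hSW⟩
  rw [windowDistribution, dif_pos hex]
  obtain ⟨h₁, h₂, h₃⟩ := hex.choose_spec
  refine hD.null_invariant _ h₁ _ hW (h.null_mono _ (h.null_union hSW h₃) _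
    ((h.measurable_window _ h₁).symmDiff (h.measurable_window _ hW)) ?_)
  intro x hx
  rw [mem_symmDiff] at hx
  grind

lemma IsWDS.windowDistribution_window (hD : IsWDS 𝒲 𝒩 𝒟) (h : IsWindowSystem 𝒲 𝒩) {W : Set T}
    (hW : W ∈ 𝒲) : windowDistribution 𝒲 𝒩 𝒟 W = 𝒟 W :=
  hD.windowDistribution_eq h hW subset_rfl (by simpa using h.empty_mem_null)

lemma IsWDS.windowDistribution_congr (hD : IsWDS 𝒲 𝒩 𝒟) (h : IsWindowSystem 𝒲 𝒩) {S S' : Set T}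
    (hS : S ∈ windowAlgebra 𝒲 𝒩) (hS' : S ∉ 𝒩) (hSS' : S ⊆ S') (hN : S' \ S ∈ 𝒩) :
    windowDistribution 𝒲 𝒩 𝒟 S' = windowDistribution 𝒲 𝒩 𝒟 S := by
  obtain ⟨W, hW, hWS, hSW⟩ := hS.resolve_left hS'
  rw [hD.windowDistribution_eq h hW hWS hSW, hD.windowDistribution_eq h hW (hWS.trans hSS') ?_]
  convert h.null_union hSW hN using 1
  grind

/-- An increasing sequence of non-null members of the algebra is, up to null windows, an
increasing sequence of windows. -/
lemma IsWindowSystem.exists_monotone_windows_s12 (h : IsWindowSystem 𝒲 𝒩)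
    (hA : IsSetAlgebra (windowAlgebra 𝒲 𝒩)) {S : ℕ → Set T} (hS : Monotone S)
    (hmem : ∀ n, S n ∈ windowAlgebra 𝒲 𝒩) (hnull : S 0 ∉ 𝒩) :
    ∃ V : ℕ → Set T, Monotone V ∧ ∀ n, V n ∈ 𝒲 ∧ V n ⊆ S n ∧ S n \ V n ∈ 𝒩 := by
  have step : ∀ n V, V ∈ 𝒲 ∧ V ⊆ S n ∧ S n \ V ∈ 𝒩 →
      ∃ V', (V' ∈ 𝒲 ∧ V' ⊆ S (n + 1) ∧ S (n + 1) \ V' ∈ 𝒩) ∧ V ⊆ V' := by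
    rintro n V ⟨hV, hVS, hN⟩
    have hVS' := hVS.trans (hS n.le_succ)
    rcases hA.sdiff_mem (hmem (n + 1)) (h.window_subset_windowAlgebra hV) with
      hd | ⟨W, hW, hWS, hWN⟩
    · exact ⟨V, ⟨hV, hVS', hd⟩, subset_rfl⟩
    · refine ⟨V ∪ W, ⟨h.window_disjUnion _ hV _ hW ?_, ?_, ?_⟩, subset_union_left⟩
      · exact disjoint_sdiff_right.mono_right hWS
      · exact union_subset hVS' (hWS.trans sdiff_subset)
      · rwa [← sdiff_sdiff]
  choose! g hg using step
  obtain ⟨V₀, hV₀⟩ := (hmem 0).resolve_left hnull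
  let V : ℕ → Set T := fun n ↦ Nat.rec V₀ (fun n v ↦ g n v) n
  have hV : ∀ n, V n ∈ 𝒲 ∧ V n ⊆ S n ∧ S n \ V n ∈ 𝒩 := by
    intro n
    induction n with
    | zero => exact hV₀
    | succ n ih => exact (hg n _ ih).1
  exact ⟨V, monotone_nat_of_le_succ fun n ↦ (hg n _ (hV n)).2, hV⟩

lemma IsWDS.tendsto_windowDistribution (hD : IsWDS 𝒲 𝒩 𝒟) (h : IsWindowSystem 𝒲 𝒩)
    (hA : IsSetAlgebra (windowAlgebra 𝒲 𝒩)) {S : ℕ → Set T} (hS : Monotone S)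
    (hmem : ∀ n, S n ∈ windowAlgebra 𝒲 𝒩) (hU : ⋃ n, S n ∈ windowAlgebra 𝒲 𝒩)
    (hnull : ⋃ n, S n ∉ 𝒩) {F : Set X} (hF : MeasurableSet F) :
    Tendsto (fun n ↦ (windowDistribution 𝒲 𝒩 𝒟 (S n)).real F) atTop
      (𝓝 ((windowDistribution 𝒲 𝒩 𝒟 (⋃ n, S n)).real F)) := by
  wlog h₀ : S 0 ∉ 𝒩 generalizing S
  · obtain ⟨m, hm⟩ : ∃ m, S m ∉ 𝒩 := by
      by_contra! hall
      exact hnull (h.null_iUnion _ hall)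
    have hUm : ⋃ n, S (n + m) = ⋃ n, S n := hS.iUnion_nat_add m
    have := this (S := fun n ↦ S (n + m)) (fun a b hab ↦ hS (by lia)) (fun n ↦ hmem _)
      (by rwa [hUm]) (by rwa [hUm]) (by simpa using hm)
    rw [hUm] at this
    exact (tendsto_add_atTop_iff_nat m).1 this
  obtain ⟨V, hVm, hV⟩ := h.exists_monotone_windows_s12 hA hS hmem h₀
  have hVS : ⋃ n, V n ⊆ ⋃ n, S n := iUnion_mono fun n ↦ (hV n).2.1
  have mV : MeasurableSet (⋃ n, V n) := .iUnion fun n ↦ h.measurable_window _ (hV n).1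
  have mS := h.measurableSet_of_mem_windowAlgebra hU
  have hdiff : (⋃ n, S n) \ ⋃ n, V n ∈ 𝒩 := by
    refine h.null_mono _ (h.null_iUnion _ fun n ↦ (hV n).2.2) _ (mS.diff mV) ?_
    rintro x ⟨hx, hx'⟩
    obtain ⟨n, hn⟩ := mem_iUnion.1 hx
    exact mem_iUnion.2 ⟨n, hn, fun hxn ↦ hx' (mem_iUnion.2 ⟨n, hxn⟩)⟩
  have hVA : ⋃ n, V n ∈ windowAlgebra 𝒲 𝒩 := by
    refine h.windowAlgebra_of_sdiff hU mV hdiff ?_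
    rw [sdiff_eq_empty.2 hVS]
    exact h.empty_mem_null
  have hVN : ⋃ n, V n ∉ 𝒩 := fun hN ↦ hnull <| by
    rw [← union_sdiff_cancel hVS]
    exact h.null_union hN hdiff
  obtain ⟨W, hW, hWV, hWN⟩ := hVA.resolve_left hVN
  have mW := h.measurable_window _ hW
  have hVW : ∀ n, V n \ W ∈ 𝒩 := fun n ↦ h.null_mono _ hWN _
    ((h.measurable_window _ (hV n).1).diff mW) (sdiff_subset_sdiff_left (subset_iUnion V n))
  have hwin : ∀ n, V n ∩ W ∈ 𝒲 := fun n ↦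
    (h.inter_mem _ (Or.inl (hV n).1) _ (Or.inl hW)).resolve_right fun hN ↦
      h.notMem_null (hV n).1 <| by
        rw [← inter_union_sdiff (V n) W]
        exact h.null_union hN (hVW n)
  have hUW : ⋃ n, V n ∩ W = W := by rw [← iUnion_inter, inter_eq_right.2 hWV]
  have key := hD.continuous (fun n ↦ V n ∩ W) (fun a b hab ↦ inter_subset_inter_left _ (hVm hab))
    hwin (by rwa [hUW]) F hF
  rw [hUW] at key
  have e : windowDistribution 𝒲 𝒩 𝒟 (⋃ n, S n) = 𝒟 W := by
    rw [hD.windowDistribution_congr h hVA hVN hVS hdiff, hD.windowDistribution_eq h hW hWV hWN]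
  have e' : ∀ n, windowDistribution 𝒲 𝒩 𝒟 (S n) = 𝒟 (V n ∩ W) := by
    intro n
    refine hD.windowDistribution_eq h (hwin n) (inter_subset_left.trans (hV n).2.1) ?_
    refine h.null_mono _ (h.null_union (hV n).2.2 (hVW n)) _
      ((h.measurableSet_of_mem_windowAlgebra (hmem n)).diff
        (h.measurable_window _ (hwin n))) ?_
    grind
  simp only [e, e']
  have := hD.prob W hW
  exact (ENNReal.tendsto_toReal (measure_ne_top _ _)).comp key

end Extension

/-- `w` is a normalised finitely additive weight on the algebra `ℬ`, vanishing exactly on `𝒩`,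
with respect to which the distributions `K` are mixtures. -/
structure IsWeighting {X T : Type*} [MeasurableSpace X] (𝒩 : Set (Set T)) (K : Set T → Measure X)
    (ℬ : Set (Set T)) (w : Set T → ℝ) : Prop where
  add : ∀ A ∈ ℬ, ∀ B ∈ ℬ, Disjoint A B → w (A ∪ B) = w A + w B
  mix : ∀ A ∈ ℬ, ∀ B ∈ ℬ, Disjoint A B → ∀ F, MeasurableSet F →
    w (A ∪ B) * (K (A ∪ B)).real F = w A * (K A).real F + w B * (K B).real F
  pos : ∀ A ∈ ℬ, A ∉ 𝒩 → 0 < w A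
  null : ∀ A ∈ ℬ, A ∈ 𝒩 → w A = 0
  univ : w univ = 1

namespace IsWeighting

variable {X T : Type*} [MeasurableSpace X] {𝒩 ℬ ℬ' : Set (Set T)} {K : Set T → Measure X}
  {w w' : Set T → ℝ}

lemma mono (hw : IsWeighting 𝒩 K ℬ w) (hℬ : ℬ' ⊆ ℬ) : IsWeighting 𝒩 K ℬ' w where
  add A hA B hB := hw.add A (hℬ hA) B (hℬ hB)
  mix A hA B hB := hw.mix A (hℬ hA) B (hℬ hB)
  pos A hA := hw.pos A (hℬ hA)
  null A hA := hw.null A (hℬ hA)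
  univ := hw.univ

lemma nonneg (hw : IsWeighting 𝒩 K ℬ w) {A : Set T} (hA : A ∈ ℬ) : 0 ≤ w A := by
  by_cases hN : A ∈ 𝒩
  · exact (hw.null A hA hN).ge
  · exact (hw.pos A hA hN).le

lemma add_compl (hw : IsWeighting 𝒩 K ℬ w) (hℬ : IsSetAlgebra ℬ) {A : Set T} (hA : A ∈ ℬ) :
    w A + w Aᶜ = 1 := by
  rw [← hw.add A hA _ (hℬ.compl_mem hA) disjoint_compl_right, union_compl_self, hw.univ]

lemma mix_compl (hw : IsWeighting 𝒩 K ℬ w) (hℬ : IsSetAlgebra ℬ) {A : Set T} (hA : A ∈ ℬ)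
    {F : Set X} (hF : MeasurableSet F) :
    (K Set.univ).real F = w A * (K A).real F + w Aᶜ * (K Aᶜ).real F := by
  rw [← hw.mix A hA _ (hℬ.compl_mem hA) disjoint_compl_right F hF, union_compl_self, hw.univ,
    one_mul]

lemma real_compl_ne (hw : IsWeighting 𝒩 K ℬ w) (hℬ : IsSetAlgebra ℬ) {U : Set T} (hU : U ∈ ℬ)
    (hUN : U ∉ 𝒩) {F : Set X} (hF : MeasurableSet F)
    (hne : (K U).real F ≠ (K Set.univ).real F) : (K Uᶜ).real F ≠ (K Set.univ).real F := by
  intro he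
  have h₁ := hw.mix_compl hℬ hU hF
  have h₂ := hw.add_compl hℬ hU
  have h₃ : w U * ((K U).real F - (K Set.univ).real F) = 0 := by
    rw [he] at h₁
    linear_combination -h₁ - (K Set.univ).real F * h₂
  rcases mul_eq_zero.1 h₃ with h₃ | h₃
  · exact (hw.pos U hU hUN).ne' h₃
  · exact hne (sub_eq_zero.1 h₃)

lemma eq_of_real_ne (hw : IsWeighting 𝒩 K ℬ w) (hw' : IsWeighting 𝒩 K ℬ w')
    (hℬ : IsSetAlgebra ℬ) {A : Set T} (hA : A ∈ ℬ) {F : Set X} (hF : MeasurableSet F)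
    (hne : (K A).real F ≠ (K Set.univ).real F) : w A = w' A := by
  have h₁ := hw.mix_compl hℬ hA hF
  have h₂ := hw.add_compl hℬ hA
  have h₁' := hw'.mix_compl hℬ hA hF
  have h₂' := hw'.add_compl hℬ hA
  have h₃ : (w A - w' A) * ((K A).real F - (K Aᶜ).real F) = 0 := by
    linear_combination h₁' - h₁ - (K Aᶜ).real F * h₂ + (K Aᶜ).real F * h₂'
  rcases mul_eq_zero.1 h₃ with h₃ | h₃
  · exact sub_eq_zero.1 h₃
  · refine absurd ?_ hne
    linear_combination -h₁ - (K A).real F * h₂ + w Aᶜ * h₃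

lemma eq_of_subset (hw : IsWeighting 𝒩 K ℬ w) (hw' : IsWeighting 𝒩 K ℬ w')
    (hℬ : IsSetAlgebra ℬ) {A V : Set T} (hA : A ∈ ℬ) (hV : V ∈ ℬ) (hAV : A ⊆ V) {F : Set X}
    (hF : MeasurableSet F) (hne : (K V).real F ≠ (K Set.univ).real F) : w A = w' A := by
  by_cases hA' : (K A).real F = (K Set.univ).real F
  swap
  · exact hw.eq_of_real_ne hw' hℬ hA hF hA'
  have hVV := hw.eq_of_real_ne hw' hℬ hV hF hne
  have hd := hℬ.sdiff_mem hV hA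
  have h₁ := hw.mix A hA _ hd disjoint_sdiff_right F hF
  have h₂ := hw.add A hA _ hd disjoint_sdiff_right
  have h₁' := hw'.mix A hA _ hd disjoint_sdiff_right F hF
  have h₂' := hw'.add A hA _ hd disjoint_sdiff_right
  rw [union_sdiff_cancel hAV] at h₁ h₂ h₁' h₂'
  have h₃ : (w A - w' A) * ((K A).real F - (K (V \ A)).real F) = 0 := by
    linear_combination h₁' - h₁ + (K (V \ A)).real F * (h₂ - h₂') +
      ((K V).real F - (K (V \ A)).real F) * hVV
  rcases mul_eq_zero.1 h₃ with h₃ | h₃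
  · exact sub_eq_zero.1 h₃
  · have h₄ : w V * ((K V).real F - (K A).real F) = 0 := by
      linear_combination h₁ - (K A).real F * h₂ - w (V \ A) * h₃
    have h₅ : w V = 0 := (mul_eq_zero.1 h₄).resolve_right
      (sub_ne_zero.2 (by rwa [hA']))
    linarith [hw.nonneg hA, hw.nonneg hd, hw'.nonneg hA, hw'.nonneg hd]

/-- Weightings on an algebra on which `K` is not constant are unique. -/
lemma eq_of_mem (hw : IsWeighting 𝒩 K ℬ w) (hw' : IsWeighting 𝒩 K ℬ w')
    (hℬ : IsSetAlgebra ℬ) {U : Set T} (hU : U ∈ ℬ) (hUN : U ∉ 𝒩) {F : Set X}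
    (hF : MeasurableSet F) (hne : (K U).real F ≠ (K Set.univ).real F) {A : Set T} (hA : A ∈ ℬ) :
    w A = w' A := by
  have h₁ := hℬ.inter_mem hA hU
  have h₂ := hℬ.inter_mem hA (hℬ.compl_mem hU)
  have hd : Disjoint (A ∩ U) (A ∩ Uᶜ) :=
    disjoint_compl_right.mono inter_subset_right inter_subset_right
  rw [← inter_union_compl A U, hw.add _ h₁ _ h₂ hd, hw'.add _ h₁ _ h₂ hd,
    hw.eq_of_subset hw' hℬ h₁ hU inter_subset_right hF hne,
    hw.eq_of_subset hw' hℬ h₂ (hℬ.compl_mem hU) inter_subset_right hF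
      (hw.real_compl_ne hℬ hU hUN hF hne)]

lemma biUnion_mix (hw : IsWeighting 𝒩 K ℬ w) (hℬ : IsSetAlgebra ℬ) (h0 : w ∅ = 0)
    {ι : Type*} {C : ι → Set T} (hC : ∀ i, C i ∈ ℬ) (hd : Pairwise (Function.onFun Disjoint C)) {F : Set X}
    (hF : MeasurableSet F) (s : Finset ι) :
    w (⋃ i ∈ s, C i) = ∑ i ∈ s, w (C i) ∧
      w (⋃ i ∈ s, C i) * (K (⋃ i ∈ s, C i)).real F = ∑ i ∈ s, w (C i) * (K (C i)).real F := by
  classical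
  induction s using Finset.induction_on with
  | empty => simp [h0]
  | insert a s ha ih =>
    have hdis : Disjoint (C a) (⋃ i ∈ s, C i) := by
      simp only [disjoint_iUnion_right]
      intro i hi
      exact hd (by rintro rfl; exact ha hi)
    have hm := hℬ.biUnion_mem s fun i _ ↦ hC i
    rw [Finset.set_biUnion_insert, Finset.sum_insert ha, Finset.sum_insert ha, ← ih.1, ← ih.2]
    exact ⟨hw.add _ (hC a) _ hm hdis, hw.mix _ (hC a) _ hm hdis F hF⟩

end IsWeighting

section Existence

variable {X T : Type*} [MeasurableSpace X] [MeasurableSpace T] {𝒲 𝒩 : Set (Set T)}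
  {𝒟 : Set T → Measure X}

lemma IsWDS.exists_weights (hD : IsWDS 𝒲 𝒩 𝒟) (h : IsWindowSystem 𝒲 𝒩) {ι : Type*} [Fintype ι]
    {C : ι → Set T} (hC : ∀ i, C i ∈ 𝒲) (hd : Pairwise (Function.onFun Disjoint C)) :
    ∃ r : ι → ℝ, (∀ i, 0 < r i) ∧ ∀ I : Finset ι, I.Nonempty → ∀ F : Set X,
      (∑ i ∈ I, r i) * (𝒟 (⋃ i ∈ I, C i)).real F = ∑ i ∈ I, r i * (𝒟 (C i)).real F := by
  classical
  let e := Fintype.equivFin ι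
  obtain ⟨l, hl, hconv⟩ := hD.convex _ (fun k ↦ C (e.symm k)) (fun k ↦ hC _)
    (fun a b hab ↦ hd (by simpa using hab))
  refine ⟨fun i ↦ (l (e i)).toReal, fun i ↦ ENNReal.toReal_pos (hl _).1.ne' (hl _).2.ne,
    fun I hI F ↦ ?_⟩
  have hU : ⋃ k ∈ I.map e.toEmbedding, C (e.symm k) = ⋃ i ∈ I, C i := by
    ext x
    simp only [Finset.mem_map_equiv, mem_iUnion, exists_prop]
    exact e.symm.surjective.exists (p := fun i ↦ i ∈ I ∧ x ∈ C i) |>.symm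
  have key := hconv (I.map e.toEmbedding) (by simpa using hI)
    (by rw [hU]; exact h.window_biUnion hC hd hI)
  rw [hU] at key
  simp only [Finset.sum_map, Equiv.coe_toEmbedding, Equiv.symm_apply_apply] at key
  have hpos : 0 < ∑ i ∈ I, (l (e i)).toReal :=
    Finset.sum_pos (fun i _ ↦ ENNReal.toReal_pos (hl _).1.ne' (hl _).2.ne) hI
  have hsum : (∑ i ∈ I, l (e i)).toReal = ∑ i ∈ I, (l (e i)).toReal :=
    ENNReal.toReal_sum fun i _ ↦ (hl _).2.ne
  have hfin : ∀ i, IsProbabilityMeasure (𝒟 (C i)) := fun i ↦ hD.prob _ (hC i)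
  rw [key, measureReal_ennreal_smul_apply, ENNReal.toReal_inv, hsum, ← mul_assoc,
    mul_inv_cancel₀ hpos.ne', one_mul, measureReal_def, Measure.finsetSum_apply,
    ENNReal.toReal_sum]
  · simp [measureReal_def]
  · intro i _
    simpa using ENNReal.mul_ne_top (hl _).2.ne (measure_ne_top _ _)

/-- On the finite algebra of preimages under a map with finitely many values there is a
weighting. -/
lemma IsWDS.exists_isWeighting_preimage (hD : IsWDS 𝒲 𝒩 𝒟) (h : IsWindowSystem 𝒲 𝒩)
    (hu : univ ∉ 𝒩) {ι : Type*} [Finite ι] (f : T → ι)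
    (hf : ∀ i, f ⁻¹' {i} ∈ windowAlgebra 𝒲 𝒩) :
    ∃ w, IsWeighting 𝒩 (windowDistribution 𝒲 𝒩 𝒟) (range (preimage f)) w := by
  classical
  have := Fintype.ofFinite ι
  have hex : ∀ i : {i // f ⁻¹' {i} ∉ 𝒩}, ∃ W ∈ 𝒲, W ⊆ f ⁻¹' {i.1} ∧ f ⁻¹' {i.1} \ W ∈ 𝒩 :=
    fun i ↦ (hf i.1).resolve_left i.2
  choose C hC hCf hCN using hex
  have hfC : ∀ i, ∀ x ∈ C i, f x = i.1 := fun i x hx ↦ hCf i hx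
  have hd : Pairwise (Function.onFun Disjoint C) := by
    intro a b hab
    refine Set.disjoint_left.2 fun x hxa hxb ↦ hab (Subtype.ext ?_)
    rw [← hfC a x hxa, hfC b x hxb]
  have mf : ∀ i, MeasurableSet (f ⁻¹' {i}) := fun i ↦ h.measurableSet_of_mem_windowAlgebra (hf i)
  have mpre : ∀ J : Set ι, MeasurableSet (f ⁻¹' J) := fun J ↦ by
    rw [← biUnion_preimage_singleton]
    exact .biUnion J.to_countable fun i _ ↦ mf i
  have mC : ∀ i, MeasurableSet (C i) := fun i ↦ h.measurable_window _ (hC i)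
  have hM : (⋃ i, C i)ᶜ ∈ 𝒩 := by
    refine h.null_mono _ (h.null_biUnion (N := fun i ↦ f ⁻¹' {i} \ ⋃ j, C j)
      (fun i ↦ ?_) Finset.univ) _ (MeasurableSet.iUnion mC).compl ?_
    · by_cases hi : f ⁻¹' {i} ∈ 𝒩
      · exact h.null_mono _ hi _ ((mf i).diff (.iUnion mC)) sdiff_subset
      · exact h.null_mono _ (hCN ⟨i, hi⟩) _ ((mf i).diff (.iUnion mC))
          (sdiff_subset_sdiff_right (subset_iUnion C ⟨i, hi⟩))
    · intro x hx
      simpa using hx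
  obtain ⟨r, hr, hmix⟩ := hD.exists_weights h hC hd
  let I : Set T → Finset {i // f ⁻¹' {i} ∉ 𝒩} := fun S ↦ {i | f ⁻¹' {i.1} ⊆ S}
  have memI : ∀ (S : Set T) i, i ∈ I S ↔ f ⁻¹' {i.1} ⊆ S := fun S i ↦ by simp [I]
  have hCS : ∀ S, ⋃ i ∈ I S, C i ⊆ S := fun S ↦
    iUnion₂_subset fun i hi ↦ (hCf i).trans ((memI S i).1 hi)
  have hSN : ∀ S ∈ range (preimage f), S \ ⋃ i ∈ I S, C i ∈ 𝒩 := by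
    rintro _ ⟨J, rfl⟩
    refine h.null_mono _ hM _ ((mpre J).diff (.biUnion (Finset.countable_toSet _)
      fun i _ ↦ mC i)) ?_
    rintro x ⟨hx, hx'⟩ hxC
    obtain ⟨i, hi⟩ := mem_iUnion.1 hxC
    refine hx' (mem_iUnion₂.2 ⟨i, (memI _ _).2 ?_, hi⟩)
    intro y hy
    have hy' : f y = i.1 := hy
    rwa [mem_preimage, hy', ← hfC i x hi]
  have hIne : ∀ S ∈ range (preimage f), S ∉ 𝒩 → (I S).Nonempty := by
    intro S hS hSn
    by_contra hne
    rw [Finset.not_nonempty_iff_eq_empty] at hne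
    have := hSN S hS
    rw [hne] at this
    exact hSn (by simpa using this)
  have hIempty : ∀ S ∈ 𝒩, I S = ∅ := by
    intro S hS
    refine Finset.eq_empty_of_forall_notMem fun i hi ↦ ?_
    exact i.2 (h.null_mono _ hS _ (mf _) ((memI S i).1 hi))
  have key : ∀ S ∈ range (preimage f), ∀ F : Set X,
      (∑ i ∈ I S, r i) * (windowDistribution 𝒲 𝒩 𝒟 S).real F
        = ∑ i ∈ I S, r i * (𝒟 (C i)).real F := by
    intro S hS F
    by_cases hSn : S ∈ 𝒩
    · simp [hIempty S hSn]
    · have hne := hIne S hS hSn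
      rw [hD.windowDistribution_eq h (h.window_biUnion hC hd hne) (hCS S) (hSN S hS),
        hmix _ hne]
  have memI_preimage : ∀ (J : Set ι) i, i ∈ I (f ⁻¹' J) ↔ i.1 ∈ J := by
    intro J i
    obtain ⟨x, hx⟩ : (f ⁻¹' {i.1}).Nonempty := by
      rw [nonempty_iff_ne_empty]
      exact fun he ↦ i.2 (he ▸ h.empty_mem_null)
    have hx : f x = i.1 := hx
    rw [memI]
    refine ⟨fun hi ↦ hx ▸ hi hx, fun hi ↦ preimage_mono (singleton_subset_iff.2 hi)⟩
  have hIunion : ∀ A ∈ range (preimage f), ∀ B ∈ range (preimage f),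
      I (A ∪ B) = I A ∪ I B := by
    rintro _ ⟨J, rfl⟩ _ ⟨J', rfl⟩
    ext i
    rw [← preimage_union, Finset.mem_union, memI_preimage, memI_preimage, memI_preimage, mem_union]
  have hIdisj : ∀ A B, Disjoint A B → Disjoint (I A) (I B) := by
    intro A B hAB
    refine Finset.disjoint_left.2 fun i hiA hiB ↦ i.2 ?_
    have : f ⁻¹' {i.1} ⊆ ∅ := fun x hx ↦
      Set.disjoint_left.1 hAB ((memI A i).1 hiA hx) ((memI B i).1 hiB hx)
    rw [subset_empty_iff.1 this]
    exact h.empty_mem_null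
  have hpos : ∀ S ∈ range (preimage f), S ∉ 𝒩 → 0 < ∑ i ∈ I S, r i := fun S hS hSn ↦
    Finset.sum_pos (fun i _ ↦ hr i) (hIne S hS hSn)
  have hΛ := hpos univ ⟨univ, rfl⟩ hu
  refine ⟨fun S ↦ (∑ i ∈ I S, r i) / ∑ i ∈ I univ, r i, ?_, ?_, ?_, ?_, ?_⟩
  · intro A hA B hB hAB
    rw [hIunion A hA B hB, Finset.sum_union (hIdisj A B hAB), add_div]
  · intro A hA B hB hAB F _
    have hAB' : A ∪ B ∈ range (preimage f) := by
      obtain ⟨J, rfl⟩ := hA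
      obtain ⟨J', rfl⟩ := hB
      exact ⟨J ∪ J', rfl⟩
    simp only [div_mul_eq_mul_div]
    rw [key _ hAB', key _ hA, key _ hB, hIunion A hA B hB, Finset.sum_union (hIdisj A B hAB),
      add_div]
  · exact fun A hA hAn ↦ div_pos (hpos A hA hAn) hΛ
  · intro A _ hAn
    simp [hIempty A hAn]
  · exact div_self hΛ.ne'

lemma isSetAlgebra_range_preimage {α β : Type*} (f : α → β) :
    IsSetAlgebra (range (preimage f)) where
  empty_mem := ⟨∅, rfl⟩
  compl_mem := by
    rintro _ ⟨J, rfl⟩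
    exact ⟨Jᶜ, rfl⟩
  union_mem := by
    rintro _ _ ⟨J, rfl⟩ ⟨J', rfl⟩
    exact ⟨J ∪ J', rfl⟩

/-- Any three members of the window algebra lie in a subalgebra that carries a weighting. -/
lemma IsWDS.exists_isWeighting_subalgebra (hD : IsWDS 𝒲 𝒩 𝒟) (h : IsWindowSystem 𝒲 𝒩)
    (hA : IsSetAlgebra (windowAlgebra 𝒲 𝒩)) (hu : univ ∉ 𝒩) {A B U : Set T}
    (hAm : A ∈ windowAlgebra 𝒲 𝒩) (hBm : B ∈ windowAlgebra 𝒲 𝒩) (hUm : U ∈ windowAlgebra 𝒲 𝒩) :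
    ∃ ℬ w, IsSetAlgebra ℬ ∧ IsWeighting 𝒩 (windowDistribution 𝒲 𝒩 𝒟) ℬ w ∧
      A ∈ ℬ ∧ B ∈ ℬ ∧ U ∈ ℬ := by
  let f : T → Prop × Prop × Prop := fun x ↦ (x ∈ A, x ∈ B, x ∈ U)
  have hfib : ∀ S ∈ windowAlgebra 𝒲 𝒩, ∀ p : Prop, {x | (x ∈ S) = p} ∈ windowAlgebra 𝒲 𝒩 := by
    intro S hS p
    by_cases hp : p
    · simpa [hp] using hS
    · simpa [hp, compl_def] using hA.compl_mem hS
  obtain ⟨w, hw⟩ := hD.exists_isWeighting_preimage h hu f (fun ⟨p, q, r⟩ ↦ by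
    have := hA.inter_mem (hfib A hAm p) (hA.inter_mem (hfib B hBm q) (hfib U hUm r))
    convert this using 1
    ext x
    simp [f])
  refine ⟨_, w, isSetAlgebra_range_preimage f, hw, ⟨{p | p.1}, rfl⟩, ⟨{p | p.2.1}, rfl⟩,
    ⟨{p | p.2.2}, rfl⟩⟩

/-- A non-constant system with finite horizon has a weighting on the whole window algebra. -/
lemma IsWDS.exists_isWeighting (hD : IsWDS 𝒲 𝒩 𝒟) (h : IsWindowSystem 𝒲 𝒩)
    (hA : IsSetAlgebra (windowAlgebra 𝒲 𝒩)) (hu : univ ∉ 𝒩) {U : Set T}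
    (hU : U ∈ windowAlgebra 𝒲 𝒩) (hUN : U ∉ 𝒩) {F : Set X} (hF : MeasurableSet F)
    (hne : (windowDistribution 𝒲 𝒩 𝒟 U).real F ≠ (windowDistribution 𝒲 𝒩 𝒟 univ).real F) :
    ∃ w, IsWeighting 𝒩 (windowDistribution 𝒲 𝒩 𝒟) (windowAlgebra 𝒲 𝒩) w := by
  have hex : ∀ A, ∃ ℬ w, A ∈ windowAlgebra 𝒲 𝒩 → IsSetAlgebra ℬ ∧
      IsWeighting 𝒩 (windowDistribution 𝒲 𝒩 𝒟) ℬ w ∧ A ∈ ℬ ∧ U ∈ ℬ := by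
    intro A
    by_cases hAm : A ∈ windowAlgebra 𝒲 𝒩
    · obtain ⟨ℬ, w, h₁, h₂, h₃, h₄, h₅⟩ := hD.exists_isWeighting_subalgebra h hA hu hAm hAm hU
      exact ⟨ℬ, w, fun _ ↦ ⟨h₁, h₂, h₃, h₅⟩⟩
    · exact ⟨∅, 0, fun hm ↦ absurd hm hAm⟩
  choose ℬ w hBw using hex
  have huniq : ∀ A ∈ windowAlgebra 𝒲 𝒩, ∀ ℬ' w', IsSetAlgebra ℬ' →
      IsWeighting 𝒩 (windowDistribution 𝒲 𝒩 𝒟) ℬ' w' → A ∈ ℬ' → U ∈ ℬ' → w A A = w' A := by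
    intro A hAm ℬ' w' hℬ' hw' hA' hU'
    obtain ⟨h₁, h₂, h₃, h₄⟩ := hBw A hAm
    have halg : IsSetAlgebra (ℬ A ∩ ℬ') :=
      ⟨⟨h₁.empty_mem, hℬ'.empty_mem⟩, fun s hs ↦ ⟨h₁.compl_mem hs.1, hℬ'.compl_mem hs.2⟩,
        fun s t hs ht ↦ ⟨h₁.union_mem hs.1 ht.1, hℬ'.union_mem hs.2 ht.2⟩⟩
    exact (h₂.mono inter_subset_left).eq_of_mem (hw'.mono inter_subset_right) halg ⟨h₄, hU'⟩ hUN
      hF hne ⟨h₃, hA'⟩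
  refine ⟨fun A ↦ w A A, ?_, ?_, ?_, ?_, ?_⟩
  · intro A hAm B hBm hAB
    obtain ⟨ℬ', w', h₁, h₂, h₃, h₄, h₅⟩ := hD.exists_isWeighting_subalgebra h hA hu hAm hBm hU
    rw [huniq A hAm ℬ' w' h₁ h₂ h₃ h₅, huniq B hBm ℬ' w' h₁ h₂ h₄ h₅,
      huniq _ (hA.union_mem hAm hBm) ℬ' w' h₁ h₂ (h₁.union_mem h₃ h₄) h₅]
    exact h₂.add A h₃ B h₄ hAB
  · intro A hAm B hBm hAB F hF
    obtain ⟨ℬ', w', h₁, h₂, h₃, h₄, h₅⟩ := hD.exists_isWeighting_subalgebra h hA hu hAm hBm hU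
    rw [huniq A hAm ℬ' w' h₁ h₂ h₃ h₅, huniq B hBm ℬ' w' h₁ h₂ h₄ h₅,
      huniq _ (hA.union_mem hAm hBm) ℬ' w' h₁ h₂ (h₁.union_mem h₃ h₄) h₅]
    exact h₂.mix A h₃ B h₄ hAB F hF
  · intro A hAm hAN
    obtain ⟨h₁, h₂, h₃, h₄⟩ := hBw A hAm
    exact h₂.pos A h₃ hAN
  · intro A hAm hAN
    obtain ⟨h₁, h₂, h₃, h₄⟩ := hBw A hAm
    exact h₂.null A h₃ hAN
  · exact (hBw univ hA.univ_mem).2.1.univ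

/-- A weighting on the window algebra is continuous along sequences exhausting the space. -/
lemma IsWDS.tendsto_weighting_inter_compl (hD : IsWDS 𝒲 𝒩 𝒟) (h : IsWindowSystem 𝒲 𝒩)
    (hA : IsSetAlgebra (windowAlgebra 𝒲 𝒩)) (hu : univ ∉ 𝒩) {w : Set T → ℝ}
    (hw : IsWeighting 𝒩 (windowDistribution 𝒲 𝒩 𝒟) (windowAlgebra 𝒲 𝒩) w) {U : Set T}
    (hU : U ∈ windowAlgebra 𝒲 𝒩) {F : Set X} (hF : MeasurableSet F)
    (hne : (windowDistribution 𝒲 𝒩 𝒟 Uᶜ).real F ≠ (windowDistribution 𝒲 𝒩 𝒟 univ).real F)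
    {S : ℕ → Set T} (hS : Monotone S)
    (hmem : ∀ n, S n ∈ windowAlgebra 𝒲 𝒩) (hun : ⋃ n, S n = univ) :
    Tendsto (fun n ↦ w (S n ∩ Uᶜ)) atTop (𝓝 (w Uᶜ)) := by
  by_cases hUc : Uᶜ ∈ 𝒩
  · have h0 : ∀ n, w (S n ∩ Uᶜ) = w Uᶜ := by
      intro n
      have hm := hA.inter_mem (hmem n) (hA.compl_mem hU)
      rw [hw.null _ (hA.compl_mem hU) hUc, hw.null _ hm]
      exact h.null_mono _ hUc _ (h.measurableSet_of_mem_windowAlgebra hm) inter_subset_right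
    simp [h0]
  have e₁ : ⋃ n, U ∪ S n = univ := by rw [← union_iUnion, hun, union_univ]
  have e₂ : ⋃ n, S n ∩ Uᶜ = Uᶜ := by rw [← iUnion_inter, hun, univ_inter]
  have t₁ := hD.tendsto_windowDistribution h hA (S := fun n ↦ U ∪ S n)
    (fun a b hab ↦ union_subset_union_right _ (hS hab)) (fun n ↦ hA.union_mem hU (hmem n))
    (by rw [e₁]; exact hA.univ_mem) (by rwa [e₁]) hF
  have t₂ := hD.tendsto_windowDistribution h hA (S := fun n ↦ S n ∩ Uᶜ)
    (fun a b hab ↦ inter_subset_inter_left _ (hS hab))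
    (fun n ↦ hA.inter_mem (hmem n) (hA.compl_mem hU))
    (by rw [e₂]; exact hA.compl_mem hU) (by rwa [e₂]) hF
  rw [e₁] at t₁
  rw [e₂] at t₂
  have hrel : ∀ n, w (S n ∩ Uᶜ) * ((windowDistribution 𝒲 𝒩 𝒟 (U ∪ S n)).real F
      - (windowDistribution 𝒲 𝒩 𝒟 (S n ∩ Uᶜ)).real F)
      = w U * ((windowDistribution 𝒲 𝒩 𝒟 U).real F
        - (windowDistribution 𝒲 𝒩 𝒟 (U ∪ S n)).real F) := by
    intro n
    have hm := hA.inter_mem (hmem n) (hA.compl_mem hU)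
    have hd : Disjoint U (S n ∩ Uᶜ) := disjoint_compl_right.mono_right inter_subset_right
    have h₁ := hw.add U hU _ hm hd
    have h₂ := hw.mix U hU _ hm hd F hF
    have e : U ∪ S n ∩ Uᶜ = U ∪ S n := by
      ext x
      by_cases hx : x ∈ U <;> simp [hx]
    rw [e] at h₁ h₂
    linear_combination h₂ - (windowDistribution 𝒲 𝒩 𝒟 (U ∪ S n)).real F * h₁
  have tden := t₁.sub t₂
  have hden := sub_ne_zero.2 hne.symm
  have tnum := (tendsto_const_nhds (x := (windowDistribution 𝒲 𝒩 𝒟 U).real F)).sub t₁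
    |>.const_mul (w U)
  have tdiv := tnum.div tden hden
  have hlim : w U * ((windowDistribution 𝒲 𝒩 𝒟 U).real F
      - (windowDistribution 𝒲 𝒩 𝒟 univ).real F) / ((windowDistribution 𝒲 𝒩 𝒟 univ).real F
      - (windowDistribution 𝒲 𝒩 𝒟 Uᶜ).real F) = w Uᶜ := by
    rw [div_eq_iff hden]
    have h₁ := hw.add_compl hA hU
    have h₂ := hw.mix_compl hA hU hF
    linear_combination -h₂ - (windowDistribution 𝒲 𝒩 𝒟 univ).real F * h₁
  rw [hlim] at tdiv
  refine tdiv.congr' ?_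
  filter_upwards [tden.eventually_ne hden] with n hn
  exact (div_eq_iff hn).2 (hrel n).symm

end Existence

section Measure

variable {X T : Type*} [MeasurableSpace X] [MeasurableSpace T] {𝒲 𝒩 : Set (Set T)}
  {𝒟 : Set T → Measure X}

lemma IsWDS.exists_measure_of_isWeighting (hD : IsWDS 𝒲 𝒩 𝒟) (h : IsWindowSystem 𝒲 𝒩)
    (hA : IsSetAlgebra (windowAlgebra 𝒲 𝒩)) (hu : univ ∉ 𝒩)
    (hgen : ‹MeasurableSpace T› = MeasurableSpace.generateFrom (windowAlgebra 𝒲 𝒩))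
    {w : Set T → ℝ}
    (hw : IsWeighting 𝒩 (windowDistribution 𝒲 𝒩 𝒟) (windowAlgebra 𝒲 𝒩) w) {U : Set T}
    (hU : U ∈ windowAlgebra 𝒲 𝒩) (hUN : U ∉ 𝒩) {F : Set X} (hF : MeasurableSet F)
    (hne : (windowDistribution 𝒲 𝒩 𝒟 U).real F ≠ (windowDistribution 𝒲 𝒩 𝒟 univ).real F) :
    ∃ P : Measure T, ∀ S ∈ windowAlgebra 𝒲 𝒩, P S = ENNReal.ofReal (w S) := by
  have hR := hA.isSetRing
  let m : AddContent ℝ≥0∞ (windowAlgebra 𝒲 𝒩) :=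
    hR.addContent_of_union (fun S ↦ ENNReal.ofReal (w S))
      (by simp [hw.null ∅ hA.empty_mem h.empty_mem_null])
      (fun hA' hB hd ↦ by
        rw [hw.add _ hA' _ hB hd, ENNReal.ofReal_add (hw.nonneg hA') (hw.nonneg hB)])
  have hm : ∀ S, m S = ENNReal.ofReal (w S) := fun S ↦ rfl
  have hUc := hA.compl_mem hU
  have hne' := hw.real_compl_ne hA hU hUN hF hne
  have hsigma : m.IsSigmaSubadditive := by
    refine isSigmaSubadditive_of_addContent_iUnion_eq_tsum hR fun f hf hfU hd ↦ ?_
    refine addContent_iUnion_eq_sum_of_tendsto_zero hR m (fun S _ ↦ by simp [hm])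
      (fun S hS hanti hempty ↦ ?_) hf hfU hd
    have hmono : Monotone fun n ↦ (S n)ᶜ := fun a b hab ↦ compl_subset_compl.2 (hanti hab)
    have hmem : ∀ n, (S n)ᶜ ∈ windowAlgebra 𝒲 𝒩 := fun n ↦ hA.compl_mem (hS n)
    have hun : ⋃ n, (S n)ᶜ = univ := by rw [← compl_iInter, hempty, compl_empty]
    have t₁ := hD.tendsto_weighting_inter_compl h hA hu hw hU hF hne' hmono hmem hun
    have t₂ := hD.tendsto_weighting_inter_compl h hA hu hw hUc hF
      (by rwa [compl_compl]) hmono hmem hun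
    rw [compl_compl] at t₂
    have t := (t₂.add t₁).const_sub 1
    rw [hw.add_compl hA hU, sub_self] at t
    have heq : ∀ n, 1 - (w ((S n)ᶜ ∩ U) + w ((S n)ᶜ ∩ Uᶜ)) = w (S n) := by
      intro n
      rw [← hw.add _ (hA.inter_mem (hmem n) hU) _ (hA.inter_mem (hmem n) hUc)
        (disjoint_compl_right.mono inter_subset_right inter_subset_right),
        inter_union_compl]
      linarith [hw.add_compl hA (hS n)]
    simp only [heq] at t
    simpa [hm] using ENNReal.tendsto_ofReal t
  exact ⟨m.measure hR.isSetSemiring hgen.le hsigma, fun S hS ↦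
    (m.measure_eq hR.isSetSemiring hgen hsigma hS).trans (hm S)⟩

lemma IsWDS.isCompatible_of_isWeighting (hD : IsWDS 𝒲 𝒩 𝒟) (h : IsWindowSystem 𝒲 𝒩)
    (hA : IsSetAlgebra (windowAlgebra 𝒲 𝒩)) {w : Set T → ℝ}
    (hw : IsWeighting 𝒩 (windowDistribution 𝒲 𝒩 𝒟) (windowAlgebra 𝒲 𝒩) w) {P : Measure T}
    (hP : ∀ S ∈ windowAlgebra 𝒲 𝒩, P S = ENNReal.ofReal (w S)) :
    IsCompatibleTimeDistribution 𝒲 𝒩 𝒟 P where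
  pos W hW := by
    have hm := h.window_subset_windowAlgebra hW
    rw [hP W hm]
    exact ⟨ENNReal.ofReal_pos.2 (hw.pos W hm (h.notMem_null hW)), ENNReal.ofReal_lt_top⟩
  null N hN := by rw [hP N (Or.inl hN), hw.null N (Or.inl hN) hN, ENNReal.ofReal_zero]
  mix n W hW hd hU := by
    have hm : ∀ i, W i ∈ windowAlgebra 𝒲 𝒩 := fun i ↦ h.window_subset_windowAlgebra (hW i)
    have hUm := h.window_subset_windowAlgebra hU
    ext F hF
    obtain ⟨hadd, hmix⟩ := hw.biUnion_mix hA (hw.null ∅ hA.empty_mem h.empty_mem_null) hm hd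
      hF Finset.univ
    simp only [Finset.mem_univ, iUnion_true] at hadd hmix
    have hsum : ∑ i, P (W i) = ENNReal.ofReal (w (⋃ i, W i)) := by
      rw [hadd, ENNReal.ofReal_sum_of_nonneg fun i _ ↦ hw.nonneg (hm i)]
      exact Finset.sum_congr rfl fun i _ ↦ hP _ (hm i)
    have hpos := hw.pos _ hUm (h.notMem_null hU)
    have hfin : ∀ S ∈ 𝒲, ENNReal.ofReal ((windowDistribution 𝒲 𝒩 𝒟 S).real F) = 𝒟 S F := by
      intro S hS
      have := hD.prob S hS
      rw [hD.windowDistribution_window h hS, ofReal_measureReal]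
    rw [hsum, Measure.smul_apply, Measure.finsetSum_apply, smul_eq_mul,
      mul_comm, ← div_eq_mul_inv, ENNReal.eq_div_iff (ENNReal.ofReal_pos.2 hpos).ne'
        ENNReal.ofReal_ne_top,
      ← hfin _ hU, ← ENNReal.ofReal_mul hpos.le, hmix,
      ENNReal.ofReal_sum_of_nonneg fun i _ ↦ mul_nonneg (hw.nonneg (hm i)) measureReal_nonneg]
    refine Finset.sum_congr rfl fun i _ ↦ ?_
    rw [ENNReal.ofReal_mul (hw.nonneg (hm i)), hfin _ (hW i), ← hP _ (hm i), Measure.smul_apply,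
      smul_eq_mul]

/-- A compatible probability measure restricts to a weighting on the window algebra. -/
lemma IsCompatibleTimeDistribution.isWeighting {P : Measure T}
    (hP : IsCompatibleTimeDistribution 𝒲 𝒩 𝒟 P) [IsProbabilityMeasure P] (hD : IsWDS 𝒲 𝒩 𝒟)
    (h : IsWindowSystem 𝒲 𝒩) (hA : IsSetAlgebra (windowAlgebra 𝒲 𝒩)) :
    IsWeighting 𝒩 (windowDistribution 𝒲 𝒩 𝒟) (windowAlgebra 𝒲 𝒩) P.real where
  add A hAm B hBm hAB := measureReal_union hAB (h.measurableSet_of_mem_windowAlgebra hBm)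
  mix A hAm B hBm hAB F hF := by
    have hsd : ∀ {A B : Set T}, Disjoint A B → (A ∪ B) \ B = A := fun hAB ↦ by
      rw [union_sdiff_right, hAB.sdiff_eq_left]
    have hnullreal : ∀ N ∈ 𝒩, P.real N = 0 := fun N hN ↦ by simp [measureReal_def, hP.null N hN]
    wlog hBN : B ∉ 𝒩 generalizing A B
    · push Not at hBN
      by_cases hAN : A ∈ 𝒩
      · simp [hnullreal _ (h.null_union hAN hBN), hnullreal _ hAN, hnullreal _ hBN]
      · rw [union_comm, this B hBm A hAm hAB.symm hAN, add_comm]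
    by_cases hAN : A ∈ 𝒩
    · rw [measureReal_union hAB (h.measurableSet_of_mem_windowAlgebra hBm), hnullreal A hAN,
        hD.windowDistribution_congr h hBm hBN subset_union_right (by rwa [hsd hAB])]
      ring
    obtain ⟨V, hV, hVA, hVN⟩ := hAm.resolve_left hAN
    obtain ⟨W, hW, hWB, hWN⟩ := hBm.resolve_left hBN
    have hVW := hAB.mono hVA hWB
    have hU := h.window_disjUnion _ hV _ hW hVW
    have hUN : (A ∪ B) \ (V ∪ W) ∈ 𝒩 := by
      refine h.null_mono _ (h.null_union hVN hWN) _
        ((h.measurableSet_of_mem_windowAlgebra (hA.union_mem hAm hBm)).diff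
          (h.measurable_window _ hU)) ?_
      grind
    have hPeq : ∀ {S W : Set T}, W ⊆ S → S \ W ∈ 𝒩 → P.real S = P.real W := by
      intro S W hWS hN
      refine le_antisymm ?_ (measureReal_mono hWS)
      calc P.real S = P.real (W ∪ S \ W) := by rw [union_sdiff_cancel hWS]
        _ ≤ P.real W + P.real (S \ W) := measureReal_union_le _ _
        _ = P.real W := by rw [hnullreal _ hN, add_zero]
    rw [hD.windowDistribution_eq h hU (union_subset_union hVA hWB) hUN,
      hD.windowDistribution_eq h hV hVA hVN, hD.windowDistribution_eq h hW hWB hWN,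
      hPeq (union_subset_union hVA hWB) hUN, hPeq hVA hVN, hPeq hWB hWN]
    have e : ⋃ i, ![V, W] i = V ∪ W := by
      ext x
      simp [Fin.exists_fin_two]
    have hmix := hP.mix 2 ![V, W] (by simp [Fin.forall_fin_two, hV, hW]) (by
      intro i j hij
      fin_cases i <;> fin_cases j <;> first | exact absurd rfl hij | skip
      · exact hVW
      · exact hVW.symm) (by rwa [e])
    rw [e] at hmix
    simp only [Fin.sum_univ_two, Matrix.cons_val_zero, Matrix.cons_val_one] at hmix
    have := hD.prob V hV
    have := hD.prob W hW
    have hsum : (P V + P W).toReal = P.real V + P.real W :=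
      ENNReal.toReal_add (measure_ne_top _ _) (measure_ne_top _ _)
    have hpos : 0 < P.real V + P.real W :=
      add_pos_of_pos_of_nonneg (ENNReal.toReal_pos (hP.pos V hV).1.ne' (hP.pos V hV).2.ne)
        measureReal_nonneg
    rw [hmix, measureReal_union hVW (h.measurable_window _ hW), measureReal_ennreal_smul_apply,
      ENNReal.toReal_inv, hsum, ← mul_assoc, mul_inv_cancel₀ hpos.ne', one_mul, measureReal_def,
      Measure.add_apply, Measure.smul_apply, Measure.smul_apply, smul_eq_mul, smul_eq_mul,
      ENNReal.toReal_add (by finiteness) (by finiteness), ENNReal.toReal_mul, ENNReal.toReal_mul]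
    rfl
  pos A hAm hAN := by
    obtain ⟨W, hW, hWA, -⟩ := hAm.resolve_left hAN
    exact (ENNReal.toReal_pos (hP.pos W hW).1.ne' (hP.pos W hW).2.ne).trans_le
      (measureReal_mono hWA)
  null A _ hAN := by simp [measureReal_def, hP.null A hAN]
  univ := probReal_univ

end Measure

/-- A non-constant windowed distribution system with finite horizon
admits a unique compatible probability time distribution. -/
theorem exists_unique_compatible_time_distribution
    {X T : Type*} [MeasurableSpace X] [MeasurableSpace T]
    (𝒲 𝒩 : Set (Set T)) (𝒟 : Set T → Measure X)
    (hWS : IsWindowSystem 𝒲 𝒩) (hWDS : IsWDS 𝒲 𝒩 𝒟)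
    (hfh : ∃ W ∈ 𝒲, Wᶜ ∈ 𝒩)
    (hnc : ¬ IsConstantWDS 𝒲 𝒟) :
    ∃! P : Measure T, IsProbabilityMeasure P ∧ IsCompatibleTimeDistribution 𝒲 𝒩 𝒟 P := by
  obtain ⟨Ω, hΩ, hΩc⟩ := hfh
  have hA := hWS.isSetAlgebra_windowAlgebra hΩ hΩc
  have hgen := hWS.generateFrom_windowAlgebra hΩ hΩc
  have hu : univ ∉ 𝒩 := fun hN ↦ hWS.notMem_null hΩ
    (hWS.null_mono _ hN _ (hWS.measurable_window _ hΩ) (subset_univ _))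
  obtain ⟨U, hU, hUΩ⟩ : ∃ U ∈ 𝒲, 𝒟 U ≠ 𝒟 Ω := by
    by_contra! hall
    exact hnc fun W₁ h₁ W₂ h₂ ↦ (hall W₁ h₁).trans (hall W₂ h₂).symm
  have hUm := hWS.window_subset_windowAlgebra hU
  have hUN := hWS.notMem_null hU
  obtain ⟨F, hF, hne⟩ : ∃ F, MeasurableSet F ∧ (windowDistribution 𝒲 𝒩 𝒟 U).real F ≠
      (windowDistribution 𝒲 𝒩 𝒟 univ).real F := by
    by_contra! hall
    refine hUΩ (Measure.ext fun F hF ↦ ?_)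
    have := hWDS.prob U hU
    have := hWDS.prob Ω hΩ
    rw [← measureReal_eq_measureReal_iff, ← hWDS.windowDistribution_window hWS hU, hall F hF,
      hWDS.windowDistribution_eq hWS hΩ (subset_univ _) (by rwa [← compl_eq_univ_sdiff])]
  obtain ⟨w, hw⟩ := hWDS.exists_isWeighting hWS hA hu hUm hUN hF hne
  obtain ⟨P, hP⟩ := hWDS.exists_measure_of_isWeighting hWS hA hu hgen hw hUm hUN hF hne
  have hPprob : IsProbabilityMeasure P := ⟨by rw [hP _ hA.univ_mem, hw.univ, ENNReal.ofReal_one]⟩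
  refine ⟨P, ⟨hPprob, hWDS.isCompatible_of_isWeighting hWS hA hw hP⟩, ?_⟩
  rintro Q ⟨hQ, hQc⟩
  refine ext_of_generate_finite _ hgen (fun S hS S' hS' _ ↦ hA.inter_mem hS hS') (fun S hS ↦ ?_)
    (by simp)
  rw [hP S hS, ← (hQc.isWeighting hWDS hWS hA).eq_of_mem hw hA hUm hUN hF hne hS,
    ofReal_measureReal]
end

section
/- Let D and D' be probability measures on X × T, each with drift (i.e., neither is the product of its marginals). Suppose their induced windowed distribution systems coincide: a measurable S ⊆ T satisfies D(X × S) > 0 if and only if D'(X × S) > 0, and for every such S and every measurable A ⊆ X, D(A × S)/D(X × S) = D'(A × S)/D'(X × S). Then D = D'. In other words, a probability measure on X × T with drift is uniquely determined by its induced windowed distribution system alone, without knowledge of its time marginal. -/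
open MeasureTheory Set Filter Topology
open scoped ENNReal

/-- Two finitely additive set functions that agree wherever an additive `α` does not vanish
agree on all measurable sets, as soon as `α` does not vanish identically. -/
lemma eq_of_eq_of_additive_ne_zero {T : Type*} [MeasurableSpace T] {p q α : Set T → ℝ}
    (hp : ∀ S W, MeasurableSet S → MeasurableSet W → p (S ∩ W) + p (S \ W) = p S)
    (hq : ∀ S W, MeasurableSet S → MeasurableSet W → q (S ∩ W) + q (S \ W) = q S)
    (hα : ∀ S W, MeasurableSet S → MeasurableSet W → α (S ∩ W) + α (S \ W) = α S)
    (h : ∀ S, MeasurableSet S → α S ≠ 0 → p S = q S)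
    {W : Set T} (hW : MeasurableSet W) (hαW : α W ≠ 0) {S : Set T} (hS : MeasurableSet S) :
    p S = q S := by
  by_cases hαS : α S = 0
  swap
  · exact h S hS hαS
  have hSW := hα S W hS hW
  by_cases hi : α (S ∩ W) = 0
  · have hWS := hα W S hW hS
    rw [inter_comm, hi, zero_add] at hWS
    have hu := hα (S ∪ W) S (hS.union hW) hS
    have hpu := hp (S ∪ W) S (hS.union hW) hS
    have hqu := hq (S ∪ W) S (hS.union hW) hS
    rw [union_inter_cancel_left, union_sdiff_left] at hu hpu hqu
    have h₁ := h (W \ S) (hW.diff hS) (hWS ▸ hαW)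
    have h₂ := h (S ∪ W) (hS.union hW) (by rwa [← hu, hαS, zero_add, hWS])
    linarith
  · have hd : α (S \ W) ≠ 0 := fun h0 => hi (by linarith)
    have h₁ := h _ (hS.inter hW) hi
    have h₂ := h _ (hS.diff hW) hd
    linarith [hp S W hS hW, hq S W hS hW]

lemma measureReal_prod_inter_add_sdiff {X T : Type*} [MeasurableSpace X] [MeasurableSpace T]
    (D : Measure (X × T)) [IsFiniteMeasure D] (A : Set X)
    (S W : Set T) (hW : MeasurableSet W) :
    D.real (A ×ˢ (S ∩ W)) + D.real (A ×ˢ (S \ W)) = D.real (A ×ˢ S) := by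
  have h₁ : A ×ˢ (S ∩ W) = A ×ˢ S ∩ univ ×ˢ W := by
    rw [prod_inter_prod, inter_univ]
  have h₂ : A ×ˢ (S \ W) = A ×ˢ S \ univ ×ˢ W := by
    ext ⟨x, t⟩; simp; tauto
  rw [h₁, h₂]
  exact measureReal_inter_add_sdiff (MeasurableSet.univ.prod hW)

lemma exists_measureReal_prod_ne_of_ne_prod_marginals {X T : Type*} [MeasurableSpace X]
    [MeasurableSpace T] (D : Measure (X × T)) [IsProbabilityMeasure D]
    (hdrift : D ≠ (D.map Prod.fst).prod (D.map Prod.snd)) :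
    ∃ A : Set X, ∃ S : Set T, MeasurableSet A ∧ MeasurableSet S ∧
      D.real (A ×ˢ S) ≠ D.real (A ×ˢ univ) * D.real (univ ×ˢ S) := by
  by_contra! h
  have : IsProbabilityMeasure (D.map Prod.fst) :=
    Measure.isProbabilityMeasure_map measurable_fst.aemeasurable
  have : IsProbabilityMeasure (D.map Prod.snd) :=
    Measure.isProbabilityMeasure_map measurable_snd.aemeasurable
  refine hdrift (Measure.prod_eq fun A S hA hS => ?_).symm
  rw [Measure.map_apply measurable_fst hA, Measure.map_apply measurable_snd hS,
    ← prod_univ, ← univ_prod, ← ENNReal.toReal_eq_toReal_iff' (measure_ne_top _ _)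
      (ENNReal.mul_ne_top (measure_ne_top _ _) (measure_ne_top _ _)), ENNReal.toReal_mul]
  exact h A S hA hS

/-- Let `D, D'` be probability measures on `X × T`, each with drift
(i.e. neither is the product of its marginals). If their induced windowed distribution
systems coincide — a measurable `S ⊆ T` has positive time-marginal measure for `D` iff
it does for `D'`, and on such sets the window mean distributions agree — then `D = D'`:
a probability measure with drift is determined by its induced WDS alone. -/
theorem drift_measure_determined_by_induced_wds
    {X T : Type*} [MeasurableSpace X] [MeasurableSpace T]
    (D D' : Measure (X × T)) [IsProbabilityMeasure D] [IsProbabilityMeasure D']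
    (hdrift : D ≠ (D.map Prod.fst).prod (D.map Prod.snd))
    (hdrift' : D' ≠ (D'.map Prod.fst).prod (D'.map Prod.snd))
    (hpos_iff : ∀ S : Set T, MeasurableSet S →
      (0 < D (Set.univ ×ˢ S) ↔ 0 < D' (Set.univ ×ˢ S)))
    (hmean : ∀ S : Set T, MeasurableSet S → 0 < D (Set.univ ×ˢ S) →
      ∀ A : Set X, MeasurableSet A →
        D (A ×ˢ S) / D (Set.univ ×ˢ S) = D' (A ×ˢ S) / D' (Set.univ ×ˢ S)) :
    D = D' := by
  have hcross (A : Set X) (S : Set T) (hA : MeasurableSet A) (hS : MeasurableSet S) :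
      D.real (A ×ˢ S) * D'.real (univ ×ˢ S) = D'.real (A ×ˢ S) * D.real (univ ×ˢ S) := by
    rcases (zero_le (a := D (univ ×ˢ S))).eq_or_lt with h0 | h0
    · have h0' : D' (univ ×ˢ S) = 0 := by
        by_contra h
        exact ((hpos_iff S hS).2 (pos_iff_ne_zero.2 h)).ne h0
      simp [measureReal_def, ← h0, h0']
    · have h := congrArg ENNReal.toReal (hmean S hS h0 A hA)
      have h0' := (hpos_iff S hS).1 h0
      rw [ENNReal.toReal_div, ENNReal.toReal_div, div_eq_div_iff
        (ENNReal.toReal_pos h0.ne' (measure_ne_top _ _)).ne'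
        (ENNReal.toReal_pos h0'.ne' (measure_ne_top _ _)).ne'] at h
      exact h
  obtain ⟨A, W, hA, hW, hAW⟩ := exists_measureReal_prod_ne_of_ne_prod_marginals D hdrift
  have hc := hcross A univ hA .univ
  simp only [univ_prod_univ, probReal_univ, mul_one] at hc
  have hagree (S : Set T) (hS : MeasurableSet S)
      (hα : D.real (A ×ˢ S) - D.real (A ×ˢ univ) * D.real (univ ×ˢ S) ≠ 0) :
      D.real (univ ×ˢ S) = D'.real (univ ×ˢ S) := by
    have h₁ := hcross A S hA hS
    have h₂ := hcross A (univ \ S) hA (MeasurableSet.univ.diff hS)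
    have ha := measureReal_prod_inter_add_sdiff D A univ S hS
    have ha' := measureReal_prod_inter_add_sdiff D' A univ S hS
    have hp := measureReal_prod_inter_add_sdiff D univ univ S hS
    have hq := measureReal_prod_inter_add_sdiff D' univ univ S hS
    rw [univ_inter] at ha ha' hp hq
    rw [univ_prod_univ, probReal_univ] at hp hq
    rw [eq_sub_of_add_eq' ha, eq_sub_of_add_eq' ha', eq_sub_of_add_eq' hp,
      eq_sub_of_add_eq' hq, ← hc] at h₂
    refine sub_eq_zero.1 ((mul_eq_zero.1 ?_).resolve_right hα)
    linear_combination (D.real (univ ×ˢ S) - 1) * h₁ - D.real (univ ×ˢ S) * h₂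
  have hmarg (S : Set T) (hS : MeasurableSet S) :
      D.real (univ ×ˢ S) = D'.real (univ ×ˢ S) :=
    eq_of_eq_of_additive_ne_zero
      (p := fun S => D.real (univ ×ˢ S)) (q := fun S => D'.real (univ ×ˢ S))
      (α := fun S => D.real (A ×ˢ S) - D.real (A ×ˢ univ) * D.real (univ ×ˢ S))
      (fun S W _ hW => measureReal_prod_inter_add_sdiff D univ S W hW)
      (fun S W _ hW => measureReal_prod_inter_add_sdiff D' univ S W hW)
      (fun S W _ hW => by
        linear_combination measureReal_prod_inter_add_sdiff D A S W hW -
          D.real (A ×ˢ univ) * measureReal_prod_inter_add_sdiff D univ S W hW)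
      hagree hW (sub_ne_zero.2 hAW) hS
  refine Measure.ext_prod fun {B S} hB hS => ?_
  rw [← measureReal_eq_measureReal_iff]
  have h := hcross B S hB hS
  rw [← hmarg S hS] at h
  by_cases h0 : D.real (univ ×ˢ S) = 0
  · have hsub : B ×ˢ S ⊆ univ ×ˢ S := prod_mono_left (subset_univ B)
    rw [measureReal_mono_null hsub h0, measureReal_mono_null hsub (hmarg S hS ▸ h0)]
  · exact mul_right_cancel₀ h0 h
end

section
/- Let X and T be standard Borel spaces, and let (κ, P_T) and (κ', P_T') be distribution processes on X over T, each having drift. Suppose they induce the same windowed distribution system: a measurable W ⊆ T satisfies P_T(W) > 0 if and only if P_T'(W) > 0, and for every such W and every measurable A ⊆ X, (1/P_T(W)) ∫_W κ_t(A) dP_T(t) = (1/P_T'(W)) ∫_W κ'_t(A) dP_T'(t). Then P_T = P_T' and κ_t = κ'_t for P_T-almost every t ∈ T. -/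
open MeasureTheory ProbabilityTheory Set Filter Topology
open scoped ENNReal

/-- If `f` under `μ` and `g` under `ν` have the same mean over every window of positive measure,
then `f ≤ g` almost everywhere. -/
lemma ae_le_of_setLAverage_eq {T : Type*} [MeasurableSpace T] {μ ν : Measure T}
    [IsFiniteMeasure μ] [IsFiniteMeasure ν] {f g : T → ℝ≥0∞} (hf : Measurable f)
    (hg : Measurable g) (hg_top : ∫⁻ t, g t ∂ν ≠ ∞)
    (hac : ∀ W, MeasurableSet W → 0 < μ W → 0 < ν W)
    (hmean : ∀ W, MeasurableSet W → 0 < μ W →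
      ⨍⁻ t in W, f t ∂μ = ⨍⁻ t in W, g t ∂ν) :
    f ≤ᵐ[μ] g := by
  have hnull (q : ℚ) : μ ({t | g t ≤ (Real.toNNReal q : ℝ≥0∞)} ∩
      {t | (Real.toNNReal q : ℝ≥0∞) < f t}) = 0 := by
    set W : Set T := {t | g t ≤ (Real.toNNReal q : ℝ≥0∞)} ∩ {t | (Real.toNNReal q : ℝ≥0∞) < f t}
    have hW : MeasurableSet W :=
      (measurableSet_le hg measurable_const).inter (measurableSet_lt measurable_const hf)
    by_contra hpos
    have hpos' := pos_iff_ne_zero.2 hpos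
    obtain ⟨x, hx, hfx⟩ := exists_le_setLAverage hpos (measure_ne_top μ W) hf.aemeasurable
    obtain ⟨y, hy, hgy⟩ := exists_setLAverage_le (hac W hW hpos').ne' hW.nullMeasurableSet
      (ne_top_of_le_ne_top hg_top (setLIntegral_le_lintegral W g))
    rw [hmean W hW hpos'] at hfx
    exact ((hx.2.trans_le hfx).trans_le (hgy.trans hy.1)).false
  refine measure_mono_null (fun t ht => ?_) (measure_iUnion_null hnull)
  obtain ⟨q, -, hgq, hqf⟩ := ENNReal.lt_iff_exists_rat_btwn.1 (not_le.1 ht)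
  exact mem_iUnion.2 ⟨q, hgq.le, hqf⟩

/-- A measurable function that is not almost everywhere constant is split by some level into two
parts of positive measure. -/
lemma exists_level_of_prod_ne_pos {T : Type*} [MeasurableSpace T] {μ : Measure T}
    [SFinite μ] {f : T → ℝ≥0∞} (h : 0 < (μ.prod μ) {st : T × T | f st.1 ≠ f st.2}) :
    ∃ c : ℝ≥0∞, μ {t | f t ≤ c} ≠ 0 ∧ μ {t | c < f t} ≠ 0 := by
  by_contra! hc
  refine h.ne' (measure_mono_null (t := ⋃ q : ℚ,
    {t | f t ≤ (Real.toNNReal q : ℝ≥0∞)} ×ˢ {t | (Real.toNNReal q : ℝ≥0∞) < f t} ∪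
    {t | (Real.toNNReal q : ℝ≥0∞) < f t} ×ˢ {t | f t ≤ (Real.toNNReal q : ℝ≥0∞)}) ?_ ?_)
  · rintro ⟨s, t⟩ hst
    rcases lt_or_gt_of_ne hst with hlt | hlt <;>
      obtain ⟨q, -, h₁, h₂⟩ := ENNReal.lt_iff_exists_rat_btwn.1 hlt
    · exact mem_iUnion.2 ⟨q, Or.inl ⟨h₁.le, h₂⟩⟩
    · exact mem_iUnion.2 ⟨q, Or.inr ⟨h₂, h₁.le⟩⟩
  · refine measure_iUnion_null fun q => measure_union_null ?_ ?_ <;>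
      rw [Measure.prod_prod, mul_eq_zero] <;>
      have := hc (Real.toNNReal q : ℝ≥0∞) <;> tauto

/-- The integral over a window in real terms: the measure of the window times the mean. -/
lemma toReal_setLIntegral_eq_measureReal_mul {T : Type*} [MeasurableSpace T] (μ : Measure T)
    [IsFiniteMeasure μ] (f : T → ℝ≥0∞) (W : Set T) :
    (∫⁻ t in W, f t ∂μ).toReal = μ.real W * (⨍⁻ t in W, f t ∂μ).toReal := by
  rw [← measure_mul_setLAverage f (measure_ne_top μ W), ENNReal.toReal_mul, Measure.real]

/-- Two measures for which corresponding functions have the same window means give the same ratio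
to windows on opposite sides of a level of the function. -/
lemma measureReal_mul_eq_of_setLAverage_eq {T : Type*} [MeasurableSpace T] {μ ν : Measure T}
    [IsFiniteMeasure μ] [IsFiniteMeasure ν] {f g : T → ℝ≥0∞} (hf : Measurable f)
    (hf_top : ∫⁻ t, f t ∂μ ≠ ∞) (hg_top : ∫⁻ t, g t ∂ν ≠ ∞)
    (hpos_iff : ∀ W, MeasurableSet W → (0 < μ W ↔ 0 < ν W))
    (hmean : ∀ W, MeasurableSet W → 0 < μ W →
      ⨍⁻ t in W, f t ∂μ = ⨍⁻ t in W, g t ∂ν)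
    {c : ℝ≥0∞} {U V : Set T} (hU : MeasurableSet U) (hV : MeasurableSet V)
    (hUc : ∀ t ∈ U, f t ≤ c) (hVc : ∀ t ∈ V, c < f t) :
    μ.real U * ν.real V = ν.real U * μ.real V := by
  have hzero (W : Set T) (hW : MeasurableSet W) (h : μ W = 0) : ν W = 0 := by
    simpa [h] using hpos_iff W hW
  rcases eq_or_ne (μ U) 0 with hU₀ | hU₀
  · simp [Measure.real, hU₀, hzero U hU hU₀]
  rcases eq_or_ne (μ V) 0 with hV₀ | hV₀
  · simp [Measure.real, hV₀, hzero V hV hV₀]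
  have hdisj : Disjoint U V :=
    Set.disjoint_left.2 fun t htU htV => ((hVc t htV).trans_le (hUc t htU)).false
  have hUV₀ : 0 < μ (U ∪ V) :=
    (pos_iff_ne_zero.2 hU₀).trans_le (measure_mono subset_union_left)
  have hf_fin (W : Set T) : ∫⁻ t in W, f t ∂μ ≠ ∞ :=
    ne_top_of_le_ne_top hf_top (setLIntegral_le_lintegral W f)
  have hg_fin (W : Set T) : ∫⁻ t in W, g t ∂ν ≠ ∞ :=
    ne_top_of_le_ne_top hg_top (setLIntegral_le_lintegral W g)
  have hlt : (⨍⁻ t in U, f t ∂μ).toReal < (⨍⁻ t in V, f t ∂μ).toReal := by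
    obtain ⟨x, hx, hfx⟩ := exists_setLAverage_le hU₀ hU.nullMeasurableSet (hf_fin U)
    obtain ⟨y, hy, hfy⟩ := exists_le_setLAverage hV₀ (measure_ne_top μ V) hf.aemeasurable
    exact ENNReal.toReal_strict_mono (setLAverage_lt_top (hf_fin V)).ne
      ((hfx.trans (hUc x hx)).trans_lt ((hVc y hy).trans_le hfy))
  have hμ := congrArg ENNReal.toReal (lintegral_union (μ := μ) (f := f) hV hdisj)
  have hν := congrArg ENNReal.toReal (lintegral_union (μ := ν) (f := g) hV hdisj)
  rw [ENNReal.toReal_add (hf_fin U) (hf_fin V)] at hμ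
  rw [ENNReal.toReal_add (hg_fin U) (hg_fin V)] at hν
  simp only [toReal_setLIntegral_eq_measureReal_mul] at hμ hν
  rw [← hmean _ (hU.union hV) hUV₀, ← hmean U hU (pos_iff_ne_zero.2 hU₀),
    ← hmean V hV (pos_iff_ne_zero.2 hV₀), measureReal_union hdisj hV] at hν
  rw [measureReal_union hdisj hV] at hμ
  refine mul_right_cancel₀ (sub_ne_zero.2 hlt.ne) ?_
  linear_combination (μ.real U + μ.real V) * hν - (ν.real U + ν.real V) * hμ

/-- Two probability measures agree if some function that is not almost everywhere constant has the
same window means as a corresponding function under the other measure. -/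
lemma eq_of_setLAverage_eq {T : Type*} [MeasurableSpace T] {μ ν : Measure T}
    [IsProbabilityMeasure μ] [IsProbabilityMeasure ν] {f g : T → ℝ≥0∞} (hf : Measurable f)
    (hf_top : ∫⁻ t, f t ∂μ ≠ ∞) (hg_top : ∫⁻ t, g t ∂ν ≠ ∞)
    (hpos_iff : ∀ W, MeasurableSet W → (0 < μ W ↔ 0 < ν W))
    (hmean : ∀ W, MeasurableSet W → 0 < μ W →
      ⨍⁻ t in W, f t ∂μ = ⨍⁻ t in W, g t ∂ν)
    (hne : 0 < (μ.prod μ) {st : T × T | f st.1 ≠ f st.2}) :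
    μ = ν := by
  obtain ⟨c, hlow₀, hhigh₀⟩ := exists_level_of_prod_ne_pos hne
  set L : Set T := {t | f t ≤ c} with hL_def
  have hLc : {t | c < f t} = Lᶜ := by ext; simp [hL_def]
  rw [hLc] at hhigh₀
  have hL : MeasurableSet L := measurableSet_le hf measurable_const
  have hratio {U V : Set T} (hU : MeasurableSet U) (hV : MeasurableSet V) (hUL : U ⊆ L)
      (hVL : V ⊆ Lᶜ) : μ.real U * ν.real V = ν.real U * μ.real V :=
    measureReal_mul_eq_of_setLAverage_eq hf hf_top hg_top hpos_iff hmean hU hV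
      (fun _ ht => hUL ht) (fun _ ht => not_le.1 (hVL ht))
  have hμc := probReal_compl_eq_one_sub (μ := μ) hL
  have hνc := probReal_compl_eq_one_sub (μ := ν) hL
  have hμν : μ.real L = ν.real L := by
    have := hratio hL hL.compl subset_rfl subset_rfl
    rw [hμc, hνc] at this
    linarith
  have hμνc : μ.real Lᶜ = ν.real Lᶜ := by rw [hμc, hνc, hμν]
  have hL₀ : μ.real L ≠ 0 := (measureReal_ne_zero_iff).2 hlow₀
  have hLc₀ : μ.real Lᶜ ≠ 0 := (measureReal_ne_zero_iff).2 hhigh₀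
  ext S hS
  rw [← measureReal_eq_measureReal_iff, ← measureReal_inter_add_sdiff (μ := μ) (s := S) hL,
    ← measureReal_inter_add_sdiff (μ := ν) (s := S) hL]
  congr 1
  · have := hratio (hS.inter hL) hL.compl inter_subset_right subset_rfl
    rw [← hμνc] at this
    exact mul_right_cancel₀ hLc₀ this
  · have := hratio hL (hS.diff hL) subset_rfl (fun _ ht => ht.2)
    rw [← hμν] at this
    exact (mul_left_cancel₀ hL₀ this).symm

/-- Let `X` and `T` be standard Borel spaces and `(κ, P)`, `(κ', P')`
distribution processes on `X` over `T`, each having drift (there is a measurable `A` with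
`(P ⊗ P) {(s,t) | κ_s A ≠ κ_t A} > 0`, and likewise for `(κ', P')`). If they induce the
same windowed distribution system — a measurable `W` has `P W > 0` iff `P' W > 0`, and for
every such `W` and every measurable `A` the window means
`(P W)⁻¹ ∫_W κ_t A ∂P` and `(P' W)⁻¹ ∫_W κ'_t A ∂P'` agree — then `P = P'` and
`κ_t = κ'_t` for `P`-almost every `t`. -/
theorem distribution_process_determined_by_induced_wds
    {X T : Type*} [MeasurableSpace X] [MeasurableSpace T]
    [StandardBorelSpace X] [StandardBorelSpace T]
    (κ κ' : Kernel T X) [IsMarkovKernel κ] [IsMarkovKernel κ']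
    (P P' : Measure T) [IsProbabilityMeasure P] [IsProbabilityMeasure P']
    (hdrift : ∃ A : Set X, MeasurableSet A ∧
      0 < (P.prod P) {st : T × T | κ st.1 A ≠ κ st.2 A})
    (hdrift' : ∃ A : Set X, MeasurableSet A ∧
      0 < (P'.prod P') {st : T × T | κ' st.1 A ≠ κ' st.2 A})
    (hpos_iff : ∀ W : Set T, MeasurableSet W → (0 < P W ↔ 0 < P' W))
    (hmean : ∀ W : Set T, MeasurableSet W → 0 < P W →
      ∀ A : Set X, MeasurableSet A →
        (P W)⁻¹ * ∫⁻ t in W, κ t A ∂P = (P' W)⁻¹ * ∫⁻ t in W, κ' t A ∂P') :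
    P = P' ∧ ∀ᵐ t ∂P, κ t = κ' t := by
  have hmean' (A : Set X) (hA : MeasurableSet A) (W : Set T) (hW : MeasurableSet W)
      (hW₀ : 0 < P W) : ⨍⁻ t in W, κ t A ∂P = ⨍⁻ t in W, κ' t A ∂P' := by
    simpa only [setLAverage_eq, ENNReal.div_eq_inv_mul] using hmean W hW hW₀ A hA
  have hfin (η : Kernel T X) [IsMarkovKernel η] (Q : Measure T) [IsProbabilityMeasure Q]
      (A : Set X) : ∫⁻ t, η t A ∂Q ≠ ∞ :=
    ne_top_of_le_ne_top (by simp) (lintegral_mono (g := 1) fun _ => prob_le_one)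
  obtain rfl : P = P' := by
    obtain ⟨A, hA, hne⟩ := hdrift
    exact eq_of_setLAverage_eq (κ.measurable_coe hA) (hfin κ P A) (hfin κ' P' A) hpos_iff
      (hmean' A hA) hne
  refine ⟨rfl, Kernel.ae_eq_of_compProd_eq (Measure.ext_prod fun {W A} hW hA => ?_)⟩
  have hae : ∀ᵐ t ∂P, κ t A = κ' t A := by
    have hle := ae_le_of_setLAverage_eq (κ.measurable_coe hA) (κ'.measurable_coe hA)
      (hfin κ' P A) (fun _ _ => id) (hmean' A hA)
    have hge := ae_le_of_setLAverage_eq (κ'.measurable_coe hA) (κ.measurable_coe hA)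
      (hfin κ P A) (fun _ _ => id) (fun W hW hW₀ => (hmean' A hA W hW hW₀).symm)
    exact hle.antisymm hge
  rw [Measure.compProd_apply_prod hW hA, Measure.compProd_apply_prod hW hA]
  exact lintegral_congr_ae (ae_restrict_of_ae hae)
end
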